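/- Fix r ∈ (0,1) and an integer m ≥ 2, let μ₀ be the restriction of planar Lebesgue (area) measure to G_{r,m}, and let J be a compact subset of ∂G_{r,m}. Then, uniformly for z₀ ∈ J and a, b in compact subsets of ℂ, as n → ∞, K_n(z₀ + a/n, z₀ + b/n; μ₀) = n²·H(A)·|z₀|^{2m−2}/(2π r^{2m}) + o(n²), where w₀ = (z₀^m − 1)/r^m and A = (w̄₀ a z₀^{m−1} + w₀ b̄ z̄₀^{m−1})/r^m. -/

import Mathlib

open MeasureTheory Filter Set Topology ComplexConjugate

noncomputable section

/-- Rising factorial (Pochhammer symbol) `(v)_k`. -/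
def risingFac (v : ℂ) (k : ℕ) : ℂ := (ascPochhammer ℂ k).eval v

/-- Real rising factorial. -/
def risingFacR (v : ℝ) (k : ℕ) : ℝ := (ascPochhammer ℝ k).eval v

/-- The confluent hypergeometric function `₁F₁(a;b;z)`. -/
def oneF1 (a b z : ℂ) : ℂ :=
  ∑' k : ℕ, risingFac a k / risingFac b k * z ^ k / (Nat.factorial k : ℂ)

/-- The terminating Gauss hypergeometric sum `₂F₁(-m, c; d; x)`. -/
def twoF1t (m : ℕ) (c d x : ℂ) : ℂ :=
  ∑ k ∈ Finset.range (m + 1), (m.choose k : ℂ) * (risingFac c k / risingFac d k) * (-x) ^ k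

/-- Real version of the terminating Gauss hypergeometric sum. -/
def twoF1tR (m : ℕ) (c d x : ℝ) : ℝ :=
  ∑ k ∈ Finset.range (m + 1), (m.choose k : ℝ) * (risingFacR c k / risingFacR d k) * (-x) ^ k

/-- The polynomial reproducing kernel built from a family of polynomials. -/
def repKernel (φ : ℕ → Polynomial ℂ) (n : ℕ) (z w : ℂ) : ℂ :=
  ∑ j ∈ Finset.range (n + 1), (φ j).eval z * conj ((φ j).eval w)

/-- `φ` is the family of orthonormal polynomials of `μ`, with (positive real) leading
coefficients `κ`. -/
structure IsOrthonormalPolys (μ : Measure ℂ) (φ : ℕ → Polynomial ℂ) (κ : ℕ → ℝ) : Prop where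
  natDegree_eq : ∀ n, (φ n).natDegree = n
  lead_pos : ∀ n, 0 < κ n
  lead_eq : ∀ n, (φ n).leadingCoeff = (κ n : ℂ)
  orthonormal : ∀ m n, ∫ z, (φ m).eval z * conj ((φ n).eval z) ∂μ = if m = n then 1 else 0

/-- The (closed) support of a measure on `ℂ`. -/
def msupport (μ : Measure ℂ) : Set ℂ := {z | ∀ U : Set ℂ, IsOpen U → z ∈ U → 0 < μ U}

/-- Logarithmic capacity of a compact set, defined via the transfinite diameter. -/
def capacity (K : Set ℂ) : ℝ :=
  ⨅ n : ℕ, ⨆ f : {f : Fin (n + 2) → ℂ // ∀ i, f i ∈ K},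
    (∏ p ∈ Finset.univ.filter (fun p : Fin (n + 2) × Fin (n + 2) => p.1 < p.2),
        ‖f.1 p.1 - f.1 p.2‖) ^ (2 / (((n : ℝ) + 2) * ((n : ℝ) + 1)))

/-- Stahl–Totik regularity of a measure `μ` whose orthonormal polynomials have leading
coefficients `κ`:  `κ n ^ (1/n) → 1 / cap (supp μ)`. -/
def IsRegularST (μ : Measure ℂ) (κ : ℕ → ℝ) : Prop :=
  Tendsto (fun n : ℕ => κ n ^ ((n : ℝ)⁻¹)) atTop (𝓝 (1 / capacity (msupport μ)))

/-- The Christoffel function `λ_n(z; μ)`. -/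
def christoffel (μ : Measure ℂ) (n : ℕ) (z : ℂ) : ℝ :=
  sInf {x : ℝ | ∃ P : Polynomial ℂ, P.natDegree ≤ n ∧ P.eval z = 1 ∧
    x = ∫ w, ‖P.eval w‖ ^ 2 ∂μ}

/-- Arclength measure `dθ` on the unit circle (parametrized over `[0, 2π]`). -/
def circleArc : Measure ℂ :=
  Measure.map (fun θ : ℝ => Complex.exp (Complex.I * θ)) (volume.restrict (Icc (0:ℝ) (2 * Real.pi)))

/-- The measure `w(θ) dθ/(2π)` on the unit circle. -/
def circleAC (w : ℝ → ℝ) : Measure ℂ :=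
  Measure.map (fun θ : ℝ => Complex.exp (Complex.I * θ))
    ((volume.restrict (Icc (0:ℝ) (2 * Real.pi))).withDensity fun θ =>
      ENNReal.ofReal (w θ / (2 * Real.pi)))

/-- The Hua–Pickrell weight. -/
def hpWeight (γ τ : ℝ) (θ : ℝ) : ℝ :=
  (4:ℝ) ^ γ * ‖Complex.Gamma (1 + (γ:ℂ) + Complex.I * (τ:ℂ))‖ ^ 2
      / Real.Gamma (2 * γ + 1)
    * Real.exp ((Real.pi - θ) * τ) * Real.sin (θ / 2) ^ (2 * γ)

/-- The Hua–Pickrell measure on the unit circle. -/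
def huaPickrell (γ τ : ℝ) : Measure ℂ := circleAC (hpWeight γ τ)

/-- The limiting kernel appearing in Theorem 1.1, with the diagonal `a = b̄` interpreted
by continuity. -/
def hpLimitKernel (γ τ : ℝ) (a b : ℂ) : ℂ :=
  let y : ℂ := (γ:ℂ) + Complex.I * (τ:ℂ)
  let c : ℂ := 2 * (γ:ℂ) + 1
  if a = conj b then
    oneF1 (1 + conj y) c (-Complex.I * conj b) * oneF1 (2 + y) (c + 1) (Complex.I * conj b)
        * (1 + y)
      - oneF1 (conj y) c (-Complex.I * conj b) * oneF1 (1 + y) (c + 1) (Complex.I * conj b) * y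
  else
    c * (oneF1 (conj y) c (-Complex.I * conj b) * oneF1 y c (Complex.I * a)
        - oneF1 (1 + conj y) c (-Complex.I * conj b) * oneF1 (1 + y) c (Complex.I * a))
      / (Complex.I * (conj b - a))

/-- The lemniscate region `G_{r,m} = {z : |z^m - 1| < r^m}`. -/
def lemniscate (r : ℝ) (m : ℕ) : Set ℂ := {z : ℂ | ‖z ^ m - 1‖ < r ^ m}

/-- The function `H = ₁F₁(2;3;·)`. -/
def Hfun (t : ℂ) : ℂ := if t = 0 then 1 else 2 * (Complex.exp t * (t - 1) + 1) / t ^ 2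

/-- The function `T` of (2.1). -/
def Tfun (γ : ℝ) (a : ℝ) : ℂ :=
  oneF1 (1 + (γ:ℂ)) (2 * (γ:ℂ) + 1) (-Complex.I * (a:ℂ))
      * oneF1 (2 + (γ:ℂ)) (2 * (γ:ℂ) + 2) (Complex.I * (a:ℂ)) * (1 + (γ:ℂ))
    - oneF1 (γ:ℂ) (2 * (γ:ℂ) + 1) (-Complex.I * (a:ℂ))
      * oneF1 (1 + (γ:ℂ)) (2 * (γ:ℂ) + 2) (Complex.I * (a:ℂ)) * (γ:ℂ)

end

lemma aux_integral_sum_sq {μ : Measure ℂ} {n : ℕ} (e : ℕ → ℂ → ℂ) (N : ℕ → ℝ)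
    (hint : ∀ i j, Integrable (fun z => e i z * conj (e j z)) μ)
    (horth : ∀ i j, ∫ z, e i z * conj (e j z) ∂μ = if i = j then (N i : ℂ) else 0)
    (a : ℕ → ℂ) :
    ∫ z, ‖∑ j ∈ Finset.range n, a j * e j z‖ ^ 2 ∂μ
      = ∑ j ∈ Finset.range n, ‖a j‖ ^ 2 * N j := by
  have h1 : ∀ z, ((‖∑ j ∈ Finset.range n, a j * e j z‖ ^ 2 : ℝ) : ℂ)
      = ∑ i ∈ Finset.range n, ∑ j ∈ Finset.range n,
          (a i * conj (a j)) * (e i z * conj (e j z)) := by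
    intro z
    push_cast
    rw [← Complex.mul_conj', map_sum, Finset.sum_mul_sum]
    refine Finset.sum_congr rfl fun i _ => Finset.sum_congr rfl fun j _ => ?_
    rw [map_mul]; ring
  have h2 : ((∫ z, ‖∑ j ∈ Finset.range n, a j * e j z‖ ^ 2 ∂μ : ℝ) : ℂ)
      = ((∑ j ∈ Finset.range n, ‖a j‖ ^ 2 * N j : ℝ) : ℂ) := by
    rw [← integral_complex_ofReal]
    simp_rw [h1]
    rw [integral_finsetSum _ (fun i _ => integrable_finsetSum _ fun j _ =>
      (hint i j).const_mul _)]
    push_cast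
    refine Finset.sum_congr rfl fun i hi => ?_
    rw [integral_finsetSum _ (fun j _ => (hint i j).const_mul _)]
    simp_rw [integral_const_mul, horth]
    simp only [mul_ite, mul_zero, Finset.sum_ite_eq, hi, if_true]
    rw [Complex.mul_conj']
  exact_mod_cast h2

lemma aux_exists_coeffs {φ : ℕ → Polynomial ℂ} (hd : ∀ n, (φ n).natDegree = n)
    (h0 : ∀ n, φ n ≠ 0) (n : ℕ) (P : Polynomial ℂ) (hP : P.natDegree < n) :
    ∃ a : ℕ → ℂ, P = ∑ j ∈ Finset.range n, Polynomial.C (a j) * φ j := by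
  let S : Polynomial.Sequence ℂ := ⟨φ, fun i => by
    rw [Polynomial.degree_eq_natDegree (h0 i), hd i]⟩
  have hu : ∀ i < n, IsUnit (S i).leadingCoeff := fun i _ => by
    rw [isUnit_iff_ne_zero, Polynomial.leadingCoeff_ne_zero]; exact h0 i
  have hs := S.span_degreeLT hu
  have hP' : P ∈ Polynomial.degreeLT ℂ n := by
    rw [Polynomial.mem_degreeLT]
    exact (Polynomial.degree_le_natDegree).trans_lt (by exact_mod_cast hP)
  rw [← hs] at hP'
  have : (S '' Set.Iio n) = (fun i => φ i) '' ((Finset.range n : Finset ℕ) : Set ℕ) := by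
    ext; simp [S]
  rw [this] at hP'
  rw [Submodule.mem_span_image_finset_iff_exists_fun'] at hP'
  obtain ⟨c, hc⟩ := hP'
  refine ⟨c, ?_⟩
  rw [← hc]
  exact Finset.sum_congr rfl fun i _ => by rw [Polynomial.smul_eq_C_mul]

section
variable {μ : Measure ℂ} {φ : ℕ → Polynomial ℂ} {κ : ℕ → ℝ}

lemma aux_ne_zero (hON : IsOrthonormalPolys μ φ κ) (n : ℕ) : φ n ≠ 0 := by
  intro h
  have h1 := hON.lead_eq n
  have h2 := hON.lead_pos n
  rw [h] at h1
  simp at h1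
  exact h2.ne' (by exact_mod_cast h1.symm)

lemma aux_expand (hON : IsOrthonormalPolys μ φ κ)
    (hint : ∀ f : ℂ → ℂ, Continuous f → Integrable f μ) (n : ℕ) (P : Polynomial ℂ)
    (hP : P.natDegree ≤ n) :
    ∃ a : ℕ → ℂ, (∀ z, P.eval z = ∑ j ∈ Finset.range (n + 1), a j * (φ j).eval z) ∧
      ∫ z, ‖P.eval z‖ ^ 2 ∂μ = ∑ j ∈ Finset.range (n + 1), ‖a j‖ ^ 2 := by
  obtain ⟨a, ha⟩ := aux_exists_coeffs hON.natDegree_eq (aux_ne_zero hON) (n + 1) P (by omega)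
  have he : ∀ z, P.eval z = ∑ j ∈ Finset.range (n + 1), a j * (φ j).eval z := by
    intro z
    rw [ha, Polynomial.eval_finsetSum]
    simp
  refine ⟨a, he, ?_⟩
  simp_rw [he]
  rw [aux_integral_sum_sq (fun j z => (φ j).eval z) (fun _ => 1)]
  · simp
  · intro i j
    exact hint _ (by fun_prop)
  · intro i j
    simpa using hON.orthonormal i j

lemma aux_ker_diag (φ : ℕ → Polynomial ℂ) (n : ℕ) (w : ℂ) :
    (repKernel φ n w w).re = ∑ j ∈ Finset.range (n + 1), ‖(φ j).eval w‖ ^ 2 := by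
  unfold repKernel
  rw [Complex.re_sum]
  refine Finset.sum_congr rfl fun j _ => ?_
  rw [Complex.mul_conj']
  exact_mod_cast rfl

lemma aux_cs (n : ℕ) (a b : ℕ → ℂ) :
    ‖∑ j ∈ Finset.range n, a j * b j‖ ^ 2 ≤
      (∑ j ∈ Finset.range n, ‖a j‖ ^ 2) * ∑ j ∈ Finset.range n, ‖b j‖ ^ 2 := by
  calc _ ≤ (∑ j ∈ Finset.range n, ‖a j‖ * ‖b j‖) ^ 2 := by
        gcongr
        refine (norm_sum_le _ _).trans (le_of_eq ?_)
        simp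
    _ ≤ _ := Finset.sum_mul_sq_le_sq_mul_sq _ _ _

lemma aux_point (hON : IsOrthonormalPolys μ φ κ)
    (hint : ∀ f : ℂ → ℂ, Continuous f → Integrable f μ) (n : ℕ) (P : Polynomial ℂ)
    (hP : P.natDegree ≤ n) (w : ℂ) :
    ‖P.eval w‖ ^ 2 ≤ (repKernel φ n w w).re * ∫ z, ‖P.eval z‖ ^ 2 ∂μ := by
  obtain ⟨a, h1, h2⟩ := aux_expand hON hint n P hP
  rw [h2, h1, aux_ker_diag, mul_comm]
  exact aux_cs _ _ _

lemma aux_trial (hON : IsOrthonormalPolys μ φ κ)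
    (hint : ∀ f : ℂ → ℂ, Continuous f → Integrable f μ) (n : ℕ) (P : Polynomial ℂ)
    (hP : P.natDegree ≤ n) (w w' : ℂ) :
    ‖P.eval w - repKernel φ n w w'‖ ^ 2 ≤ (repKernel φ n w w).re *
      (∫ z, ‖P.eval z‖ ^ 2 ∂μ - 2 * (P.eval w').re + (repKernel φ n w' w').re) := by
  obtain ⟨a, h1, h2⟩ := aux_expand hON hint n P hP
  have h3 : P.eval w - repKernel φ n w w' =
      ∑ j ∈ Finset.range (n + 1), (a j - conj ((φ j).eval w')) * (φ j).eval w := by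
    rw [h1, repKernel, ← Finset.sum_sub_distrib]
    exact Finset.sum_congr rfl fun j _ => by ring
  have h4 : ∫ z, ‖P.eval z‖ ^ 2 ∂μ - 2 * (P.eval w').re + (repKernel φ n w' w').re
      = ∑ j ∈ Finset.range (n + 1), ‖a j - conj ((φ j).eval w')‖ ^ 2 := by
    rw [h2, h1, aux_ker_diag, Complex.re_sum, Finset.mul_sum, ← Finset.sum_sub_distrib,
      ← Finset.sum_add_distrib]
    refine Finset.sum_congr rfl fun j _ => ?_
    rw [Complex.sq_norm, Complex.sq_norm, Complex.sq_norm, Complex.normSq_sub]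
    simp
    ring
  rw [h3, h4, aux_ker_diag, mul_comm]
  exact aux_cs _ _ _

/-- the kernel as a polynomial -/
lemma aux_kerpoly (hON : IsOrthonormalPolys μ φ κ)
    (hint : ∀ f : ℂ → ℂ, Continuous f → Integrable f μ) (n : ℕ) (w : ℂ) :
    ∃ P : Polynomial ℂ, P.natDegree ≤ n ∧ P.eval w = ((repKernel φ n w w).re : ℂ) ∧
      ∫ z, ‖P.eval z‖ ^ 2 ∂μ = (repKernel φ n w w).re := by
  have he : ∀ z, (∑ j ∈ Finset.range (n + 1), Polynomial.C (conj ((φ j).eval w)) * φ j).eval z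
      = ∑ j ∈ Finset.range (n + 1), conj ((φ j).eval w) * (φ j).eval z := by
    intro z
    rw [Polynomial.eval_finsetSum]; simp
  refine ⟨∑ j ∈ Finset.range (n + 1), Polynomial.C (conj ((φ j).eval w)) * φ j, ?_, ?_, ?_⟩
  · refine Polynomial.natDegree_sum_le_of_forall_le _ _ fun j hj => ?_
    refine (Polynomial.natDegree_C_mul_le _ _).trans ?_
    rw [hON.natDegree_eq]
    simp at hj; omega
  · rw [he, aux_ker_diag]
    push_cast
    refine Finset.sum_congr rfl fun j _ => ?_
    rw [Complex.conj_mul']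
  · simp_rw [he]
    rw [aux_integral_sum_sq (fun j z => (φ j).eval z) (fun _ => 1), aux_ker_diag]
    · simp
    · intro i j
      exact hint _ (by fun_prop)
    · intro i j
      simpa using hON.orthonormal i j
end


lemma aux_int_ball {E : Type*} [NormedAddCommGroup E] (ρ : ℝ) (f : ℂ → E) (hf : Continuous f) :
    Integrable f (volume.restrict (Metric.ball (0:ℂ) ρ)) :=
  (hf.continuousOn.integrableOn_compact (isCompact_closedBall (0:ℂ) ρ)).mono_set
    Metric.ball_subset_closedBall

lemma aux_angular (d : ℤ) :
    ∫ θ in Ioo (-Real.pi) Real.pi, Complex.exp (d * θ * Complex.I)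
      = if d = 0 then (2 * Real.pi : ℂ) else 0 := by
  rw [← integral_Ioc_eq_integral_Ioo, ← intervalIntegral.integral_of_le (by linarith [Real.pi_pos])]
  split_ifs with h
  · subst h
    simp; ring
  · have hd : (d : ℂ) * Complex.I ≠ 0 := by simp [h]
    have : ∀ θ : ℝ, Complex.exp (d * θ * Complex.I) = Complex.exp ((d * Complex.I) * θ) := by
      intro θ; congr 1; ring
    simp_rw [this]
    rw [integral_exp_mul_complex hd]
    have h2 : Complex.exp (d * Complex.I * (Real.pi : ℝ)) =
        Complex.exp (d * Complex.I * (-Real.pi : ℝ)) := by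
      rw [Complex.exp_eq_exp_iff_exists_int]
      exact ⟨d, by push_cast; ring⟩
    rw [h2]; simp

lemma aux_moment (ρ : ℝ) (hρ : 0 < ρ) (j k : ℕ) :
    ∫ v in Metric.ball (0:ℂ) ρ, v ^ j * conj (v ^ k)
      = if j = k then ((Real.pi * ρ ^ (2 * j + 2) / (j + 1) : ℝ) : ℂ) else 0 := by
  rw [← integral_indicator Metric.isOpen_ball.measurableSet, ← Complex.integral_comp_polarCoord_symm,
    polarCoord_target]
  have h1 : ∫ p in Ioi (0:ℝ) ×ˢ Ioo (-Real.pi) Real.pi, p.1 •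
      (Metric.ball (0:ℂ) ρ).indicator (fun v => v ^ j * conj (v ^ k)) (Complex.polarCoord.symm p)
      = ∫ p in Ioi (0:ℝ) ×ˢ Ioo (-Real.pi) Real.pi,
        ((Iio ρ).indicator (fun x : ℝ => ((x ^ (j + k + 1) : ℝ) : ℂ)) p.1) *
          Complex.exp (((j:ℤ) - (k:ℤ) : ℤ) * (p.2 : ℝ) * Complex.I) := by
    refine setIntegral_congr_fun (measurableSet_Ioi.prod measurableSet_Ioo) fun p hp => ?_
    have hp1 : 0 < p.1 := hp.1
    have hz : Complex.polarCoord.symm p = p.1 * Complex.exp (p.2 * Complex.I) := by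
      rw [Complex.polarCoord_symm_apply, Complex.exp_mul_I]
      push_cast; rfl
    have hn : ‖Complex.polarCoord.symm p‖ = p.1 := by
      rw [hz, norm_mul, Complex.norm_exp_ofReal_mul_I]; simp [hp1.le]
    by_cases h : p.1 < ρ
    · rw [indicator_of_mem (by simpa [abs_of_pos hp1] using h), indicator_of_mem (by simpa using h), hz]
      rw [mul_pow, mul_pow, map_mul, map_pow, map_pow, Complex.conj_ofReal, ← Complex.exp_conj]
      simp only [map_mul, Complex.conj_ofReal, Complex.conj_I]
      rw [← Complex.exp_nat_mul, ← Complex.exp_nat_mul]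
      have : Complex.exp (((j:ℤ) - (k:ℤ) : ℤ) * (p.2 : ℝ) * Complex.I) =
        Complex.exp (j * (p.2 * Complex.I)) * Complex.exp (k * (p.2 * -Complex.I)) := by
        rw [← Complex.exp_add]; congr 1; push_cast; ring
      rw [this, Complex.real_smul]
      push_cast
      ring
    · rw [indicator_of_notMem (by simpa [abs_of_pos hp1] using h), indicator_of_notMem (by simpa using h)]
      simp
  rw [h1, Measure.volume_eq_prod, ← Measure.prod_restrict, integral_prod_mul
    (fun x : ℝ => (Iio ρ).indicator (fun x : ℝ => ((x ^ (j + k + 1) : ℝ) : ℂ)) x)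
    (fun θ : ℝ => Complex.exp (((j:ℤ) - (k:ℤ) : ℤ) * (θ : ℝ) * Complex.I)), aux_angular]
  have h2 : ∫ x in Ioi (0:ℝ), (Iio ρ).indicator (fun x : ℝ => ((x ^ (j + k + 1) : ℝ) : ℂ)) x
      = ((ρ ^ (j + k + 2) / (j + k + 2) : ℝ) : ℂ) := by
    rw [setIntegral_indicator measurableSet_Iio, Ioi_inter_Iio, ← integral_Ioc_eq_integral_Ioo,
      ← intervalIntegral.integral_of_le hρ.le, intervalIntegral.integral_ofReal, integral_pow]
    push_cast
    norm_num
    ring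
  rw [h2]
  by_cases h : j = k
  · subst h
    simp only [sub_self, if_true]
    have : (j:ℂ) + 1 ≠ 0 := by exact_mod_cast Nat.succ_ne_zero j
    have h3 : (j:ℂ) + j + 2 ≠ 0 := by
      intro h; apply this; linear_combination h / 2
    push_cast
    rw [show 2 * j + 2 = j + j + 2 by ring]
    rw [show (j:ℂ) + j + 2 = 2 * (j + 1) by ring]
    field_simp
  · have : (j:ℤ) - k ≠ 0 := by omega
    simp [h, this]

/-- polynomial Bergman kernel of the disc of radius `ρ` -/
noncomputable def bker (ρ : ℝ) (M : ℕ) (x y : ℂ) : ℂ :=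
  ∑ k ∈ Finset.range (M + 1), (((k + 1) / (Real.pi * ρ ^ (2 * k + 2)) : ℝ) : ℂ) * (x * conj y) ^ k

lemma bker_diag (ρ : ℝ) (M : ℕ) (x : ℂ) :
    (bker ρ M x x).re = ∑ k ∈ Finset.range (M + 1),
      ((k + 1) / (Real.pi * ρ ^ (2 * k + 2))) * ‖x ^ k‖ ^ 2 := by
  unfold bker
  rw [Complex.re_sum]
  refine Finset.sum_congr rfl fun k _ => ?_
  rw [Complex.re_ofReal_mul, Complex.mul_conj', ← Complex.ofReal_pow, ← Complex.ofReal_pow,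
    Complex.ofReal_re, norm_pow]
  ring

lemma bker_diag_re (ρ : ℝ) (M : ℕ) (x : ℂ) :
    bker ρ M x x = ((bker ρ M x x).re : ℂ) := by
  rw [bker_diag, bker]
  push_cast
  refine Finset.sum_congr rfl fun k _ => ?_
  rw [Complex.mul_conj', norm_pow]
  push_cast
  ring

lemma aux_ball_norm (ρ : ℝ) (hρ : 0 < ρ) (n : ℕ) (a : ℕ → ℂ) :
    ∫ v in Metric.ball (0:ℂ) ρ, ‖∑ k ∈ Finset.range n, a k * v ^ k‖ ^ 2
      = ∑ k ∈ Finset.range n, ‖a k‖ ^ 2 * (Real.pi * ρ ^ (2 * k + 2) / (k + 1)) := by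
  refine aux_integral_sum_sq (fun k v => v ^ k)
    (fun k => Real.pi * ρ ^ (2 * k + 2) / (k + 1)) ?_ ?_ a
  · intro i j
    exact aux_int_ball ρ _ (by fun_prop)
  · intro i j
    exact aux_moment ρ hρ i j

lemma bker_point (ρ : ℝ) (hρ : 0 < ρ) (M : ℕ) (p : Polynomial ℂ) (hp : p.natDegree ≤ M) (x : ℂ) :
    ‖p.eval x‖ ^ 2 ≤ (bker ρ M x x).re * ∫ v in Metric.ball (0:ℂ) ρ, ‖p.eval v‖ ^ 2 := by
  simp_rw [Polynomial.eval_eq_sum_range' (Nat.lt_succ_of_le hp)]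
  rw [aux_ball_norm ρ hρ, bker_diag]
  set c : ℕ → ℝ := fun k => Real.pi * ρ ^ (2 * k + 2) / (k + 1) with hc
  have hcp : ∀ k, 0 < c k := fun k => by have := Real.pi_pos; simp only [hc]; positivity
  have h1 : ∀ k : ℕ, ((k + 1) / (Real.pi * ρ ^ (2 * k + 2))) = (c k)⁻¹ := fun k => by
    simp [hc]
  simp_rw [h1]
  have hs : ∀ k, ((Real.sqrt (c k) : ℝ) : ℂ) ≠ 0 := fun k => by
    exact_mod_cast (Real.sqrt_pos.2 (hcp k)).ne'
  have := aux_cs (M + 1) (fun k => (p.coeff k) * (Real.sqrt (c k) : ℝ))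
    (fun k => ((Real.sqrt (c k) : ℝ) : ℂ)⁻¹ * x ^ k)
  calc _ = ‖∑ k ∈ Finset.range (M + 1), ((p.coeff k) * (Real.sqrt (c k) : ℝ)) *
        (((Real.sqrt (c k) : ℝ) : ℂ)⁻¹ * x ^ k)‖ ^ 2 := by
        congr 2
        refine Finset.sum_congr rfl fun k _ => ?_
        have := hs k
        field_simp
    _ ≤ _ := this
    _ = _ := by
        rw [mul_comm]
        congr 1
        · refine Finset.sum_congr rfl fun k _ => ?_
          rw [norm_mul, mul_pow, norm_inv, Complex.norm_real, Real.norm_of_nonneg (Real.sqrt_nonneg _),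
            inv_pow, Real.sq_sqrt (hcp k).le]
        · refine Finset.sum_congr rfl fun k _ => ?_
          rw [norm_mul, mul_pow, Complex.norm_real, Real.norm_of_nonneg (Real.sqrt_nonneg _),
            Real.sq_sqrt (hcp k).le]

lemma bker_norm (ρ : ℝ) (hρ : 0 < ρ) (M : ℕ) (y : ℂ) :
    ∫ v in Metric.ball (0:ℂ) ρ, ‖bker ρ M v y‖ ^ 2 = (bker ρ M y y).re := by
  have h : ∀ v, bker ρ M v y = ∑ k ∈ Finset.range (M + 1),
      ((((k + 1) / (Real.pi * ρ ^ (2 * k + 2)) : ℝ) : ℂ) * conj y ^ k) * v ^ k := by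
    intro v
    refine Finset.sum_congr rfl fun k _ => ?_
    rw [mul_pow]; ring
  rw [bker_diag]
  simp_rw [h]
  rw [aux_ball_norm ρ hρ]
  refine Finset.sum_congr rfl fun k _ => ?_
  have := Real.pi_pos
  rw [norm_mul, Complex.norm_real, Real.norm_of_nonneg (by positivity), norm_pow, norm_pow,
    RCLike.norm_conj]
  field_simp


/-- branch of the `m`-th root of `1 + v` -/
noncomputable def bet (m : ℕ) (v : ℂ) : ℂ := (1 + v) ^ ((m:ℂ)⁻¹)

/-- its derivative -/
noncomputable def dbet (m : ℕ) (v : ℂ) : ℂ := (m:ℂ)⁻¹ * (1 + v) ^ ((m:ℂ)⁻¹ - 1)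

/-- the `m`-th roots of unity -/
noncomputable def rts (m : ℕ) : Finset ℂ := Polynomial.nthRootsFinset m (1:ℂ)

lemma mem_rts {m : ℕ} (hm : 0 < m) {c : ℂ} : c ∈ rts m ↔ c ^ m = 1 :=
  Polynomial.mem_nthRootsFinset hm 1

lemma slit {v : ℂ} (hv : ‖v‖ < 1) : 1 + v ∈ Complex.slitPlane := by
  left
  have := Complex.abs_re_le_norm v
  have := abs_le.1 this
  simp; linarith

lemma bet_pow {m : ℕ} (hm : 0 < m) (v : ℂ) : bet m v ^ m = 1 + v :=
  Complex.cpow_nat_inv_pow _ hm.ne'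

lemma bet_ne {m : ℕ} (hm : 0 < m) {v : ℂ} (hv : ‖v‖ < 1) : bet m v ≠ 0 := by
  intro h
  have h1 := bet_pow hm v
  rw [h, zero_pow hm.ne'] at h1
  exact Complex.slitPlane_ne_zero (slit hv) h1.symm

lemma bet_deriv (m : ℕ) {v : ℂ} (hv : ‖v‖ < 1) : HasDerivAt (bet m) (dbet m v) v := by
  have h1 : HasDerivAt (fun v : ℂ => 1 + v) 1 v := (hasDerivAt_id v).const_add 1
  have := h1.cpow_const (c := (m:ℂ)⁻¹) (slit hv)
  rw [mul_one] at this
  exact this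

lemma bet_dbet {m : ℕ} (hm : 0 < m) {v : ℂ} (hv : ‖v‖ < 1) :
    m * bet m v ^ (m - 1) * dbet m v = 1 := by
  have h0 := Complex.slitPlane_ne_zero (slit hv)
  have hb := bet_ne hm hv
  have h1 : dbet m v = (m:ℂ)⁻¹ * (bet m v / bet m v ^ m) := by
    rw [bet_pow hm, dbet, Complex.cpow_sub _ _ h0, Complex.cpow_one, bet]
  have h2 : bet m v ^ m = bet m v ^ (m - 1) * bet m v := by
    rw [← pow_succ, Nat.sub_add_cancel hm]
  have : (m:ℂ) ≠ 0 := by exact_mod_cast hm.ne'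
  rw [h1, h2]
  field_simp

lemma norm_dbet {m : ℕ} (hm : 0 < m) {v : ℂ} (hv : ‖v‖ < 1) :
    m * ‖bet m v‖ ^ (m - 1) * ‖dbet m v‖ = 1 := by
  have := congrArg norm (bet_dbet hm hv)
  simpa using this

lemma rts_bet {m : ℕ} (hm : 0 < m) {c v : ℂ} (hc : c ∈ rts m) : (c * bet m v) ^ m - 1 = v := by
  rw [mul_pow, (mem_rts hm).1 hc, bet_pow hm]; ring

lemma lem_cover {m : ℕ} (hm : 0 < m) {r : ℝ} (hρ1 : r ^ m < 1) :
    lemniscate r m = ⋃ c ∈ rts m, (fun v => c * bet m v) '' Metric.ball (0:ℂ) (r ^ m) := by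
  ext z
  simp only [lemniscate, mem_ofPred_eq, mem_iUnion, mem_image, Metric.mem_ball, dist_zero_right,
    exists_prop]
  constructor
  · intro hz
    have hb := bet_ne hm (hz.trans hρ1)
    refine ⟨z / bet m (z ^ m - 1), ?_, z ^ m - 1, hz, by field_simp⟩
    rw [mem_rts hm, div_pow, bet_pow hm]
    have : 1 + (z ^ m - 1) ≠ 0 := Complex.slitPlane_ne_zero (slit (hz.trans hρ1))
    rw [show z ^ m = 1 + (z ^ m - 1) by ring]
    simp only [add_sub_cancel_left]
    exact div_self this
  · rintro ⟨c, hc, v, hv, rfl⟩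
    rwa [rts_bet hm hc]

lemma det_mul_complex (a : ℂ) :
    ((ContinuousLinearMap.toSpanSingleton ℂ a : ℂ →L[ℂ] ℂ).restrictScalars ℝ : ℂ →L[ℝ] ℂ).det
      = ‖a‖ ^ 2 := by
  have : (((ContinuousLinearMap.toSpanSingleton ℂ a : ℂ →L[ℂ] ℂ).restrictScalars ℝ : ℂ →L[ℝ] ℂ) :
      ℂ →ₗ[ℝ] ℂ) = Algebra.lmul ℝ ℂ a := by
    ext x; simp [mul_comm]
  rw [ContinuousLinearMap.det, this]
  rw [← Algebra.norm_apply, Algebra.norm_complex_apply, Complex.normSq_eq_norm_sq]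

lemma lem_bdd {m : ℕ} (hm : 0 < m) {r : ℝ} (hρ1 : r ^ m < 1) :
    lemniscate r m ⊆ Metric.closedBall 0 2 := by
  intro z hz
  have hz' : ‖z ^ m - 1‖ < r ^ m := hz
  rw [mem_closedBall_zero_iff]
  by_contra h
  push Not at h
  have h1 : ‖z‖ ≤ ‖z‖ ^ m := le_self_pow₀ (by linarith) hm.ne'
  have h2 : ‖z ^ m‖ ≤ ‖z ^ m - 1‖ + 1 := by
    have := norm_add_le (z ^ m - 1) 1
    simpa using this
  rw [norm_pow] at h2
  linarith

lemma lem_meas (r : ℝ) (m : ℕ) : MeasurableSet (lemniscate r m) :=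
  (isOpen_lt (by fun_prop) (by fun_prop)).measurableSet

lemma lem_int {E : Type*} [NormedAddCommGroup E] {m : ℕ} (hm : 0 < m) {r : ℝ} (hρ1 : r ^ m < 1)
    (f : ℂ → E) (hf : Continuous f) :
    Integrable f (volume.restrict (lemniscate r m)) :=
  (hf.continuousOn.integrableOn_compact (isCompact_closedBall (0:ℂ) 2)).mono_set (lem_bdd hm hρ1)

lemma lem_cov {m : ℕ} (hm : 0 < m) {r : ℝ} (hρ1 : r ^ m < 1)
    (g : ℂ → ℝ) (hg : Continuous g) :
    (∀ c ∈ rts m, IntegrableOn (fun v => ‖dbet m v‖ ^ 2 * g (c * bet m v))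
      (Metric.ball (0:ℂ) (r ^ m))) ∧
    ∫ z in lemniscate r m, g z
      = ∫ v in Metric.ball (0:ℂ) (r ^ m), ∑ c ∈ rts m, ‖dbet m v‖ ^ 2 * g (c * bet m v) := by
  have hv1 : ∀ v ∈ Metric.ball (0:ℂ) (r ^ m), ‖v‖ < 1 := fun v hv => by
    rw [mem_ball_zero_iff] at hv; linarith
  have hinj : ∀ c ∈ rts m, InjOn (fun v => c * bet m v) (Metric.ball (0:ℂ) (r ^ m)) := by
    intro c hc v _ v' _ h
    simp only at h
    rw [← rts_bet hm hc (v := v), h, rts_bet hm hc]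
  have hder : ∀ c ∈ rts m, ∀ v ∈ Metric.ball (0:ℂ) (r ^ m),
      HasFDerivWithinAt (fun v => c * bet m v)
        ((ContinuousLinearMap.toSpanSingleton ℂ (c * dbet m v) : ℂ →L[ℂ] ℂ).restrictScalars ℝ)
        (Metric.ball (0:ℂ) (r ^ m)) v := by
    intro c hc v hv
    have := ((bet_deriv m (hv1 v hv)).const_mul c).hasFDerivAt
    exact (this.restrictScalars ℝ).hasFDerivWithinAt
  have hnc : ∀ c ∈ rts m, ‖c‖ = 1 := fun c hc =>
    Complex.norm_eq_one_of_pow_eq_one ((mem_rts hm).1 hc) hm.ne'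
  have hmeas : ∀ c ∈ rts m, MeasurableSet ((fun v => c * bet m v) '' Metric.ball (0:ℂ) (r ^ m)) :=
    fun c hc => measurable_image_of_fderivWithin Metric.isOpen_ball.measurableSet (hder c hc)
      (hinj c hc)
  have hsub : ∀ c ∈ rts m, (fun v => c * bet m v) '' Metric.ball (0:ℂ) (r ^ m) ⊆ lemniscate r m := by
    intro c hc
    rw [lem_cover hm hρ1]
    exact subset_biUnion_of_mem (u := fun c => (fun v => c * bet m v) '' Metric.ball (0:ℂ) (r ^ m)) hc
  have hio : ∀ c ∈ rts m, IntegrableOn g ((fun v => c * bet m v) '' Metric.ball (0:ℂ) (r ^ m)) :=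
    fun c hc => IntegrableOn.mono_set (lem_int hm hρ1 g hg) (hsub c hc)
  have hA : ∀ c ∈ rts m, IntegrableOn (fun v => ‖dbet m v‖ ^ 2 * g (c * bet m v))
      (Metric.ball (0:ℂ) (r ^ m)) := by
    intro c hc
    have := (integrableOn_image_iff_integrableOn_abs_det_fderiv_smul volume
      Metric.isOpen_ball.measurableSet (hder c hc) (hinj c hc) g).1 (hio c hc)
    simpa [det_mul_complex, hnc c hc] using this
  refine ⟨hA, ?_⟩
  rw [integral_finsetSum _ hA]
  conv_lhs => rw [lem_cover hm hρ1]
  rw [integral_biUnion_finset _ hmeas]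
  · refine Finset.sum_congr rfl fun c hc => ?_
    rw [integral_image_eq_integral_abs_det_fderiv_smul volume
      Metric.isOpen_ball.measurableSet (hder c hc) (hinj c hc) g]
    simp [det_mul_complex, hnc c hc]
  · intro c hc c' hc' hne
    rw [Function.onFun, Set.disjoint_left]
    rintro z ⟨v, hv, rfl⟩ ⟨v', hv', h⟩
    simp only at h
    have : v' = v := by
      rw [← rts_bet hm hc (v := v), ← h, rts_bet hm hc']
    subst this
    exact hne (mul_right_cancel₀ (bet_ne hm (hv1 _ hv)) h).symm
  · exact hio

lemma lem_rot {m : ℕ} (hm : 0 < m) {r : ℝ} (hρ1 : r ^ m < 1)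
    (g : ℂ → ℝ) (hg : Continuous g) {c : ℂ} (hc : c ∈ rts m) :
    ∫ z in lemniscate r m, g (c * z) = ∫ z in lemniscate r m, g z := by
  rw [(lem_cov hm hρ1 g hg).2, (lem_cov hm hρ1 (fun z => g (c * z)) (by fun_prop)).2]
  congr 1
  ext v
  have hc0 : c ≠ 0 := by
    rintro rfl
    have := (mem_rts hm).1 hc
    simp [hm.ne'] at this
  refine Finset.sum_bij (fun d _ => c * d) ?_ ?_ ?_ ?_
  · intro d hd
    rw [mem_rts hm] at *
    rw [mul_pow, hc, hd, one_mul]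
  · intro d _ d' _ h
    exact mul_left_cancel₀ hc0 h
  · intro d hd
    refine ⟨d / c, ?_, by field_simp⟩
    rw [mem_rts hm] at *
    rw [div_pow, hc, hd, div_one]
  · intro d _
    simp only [mul_assoc]


lemma approx_poly {ρ : ℝ} (hρ : 0 < ρ) (hρ1 : ρ < 1) (f : ℂ → ℂ)
    (hf : ∀ v : ℂ, ‖v‖ < 1 → DifferentiableAt ℂ f v) (ε : ℝ) (hε : 0 < ε) :
    ∃ g : Polynomial ℂ, ∀ v : ℂ, ‖v‖ ≤ ρ → ‖g.eval v - f v‖ ≤ ε := by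
  obtain ⟨R1, h1, h1'⟩ := exists_between hρ1
  obtain ⟨R, h2, h2'⟩ := exists_between h1'
  have hR1 : 0 < R1 := hρ.trans h1
  have hR : 0 < R := hR1.trans h2
  have hd : DifferentiableOn ℂ f (Metric.closedBall 0 ((⟨R, hR.le⟩ : NNReal) : ℝ)) := by
    intro v hv
    refine (hf v ?_).differentiableWithinAt
    rw [mem_closedBall_zero_iff] at hv
    exact lt_of_le_of_lt hv h2'
  have hs := hd.hasFPowerSeriesOnBall (by exact_mod_cast hR)
  have ht := hs.tendstoUniformlyOn (r' := ⟨R1, hR1.le⟩) (ENNReal.coe_lt_coe.2 (show (⟨R1, hR1.le⟩ : NNReal) < ⟨R, hR.le⟩ from h2))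
  rw [Metric.tendstoUniformlyOn_iff] at ht
  obtain ⟨n, hn⟩ := (ht ε hε).exists
  refine ⟨∑ k ∈ Finset.range n, Polynomial.C
    ((cauchyPowerSeries f 0 ((⟨R, hR.le⟩ : NNReal) : ℝ)).coeff k) * Polynomial.X ^ k, fun v hv => ?_⟩
  have h3 := hn v (by
    rw [mem_ball_zero_iff]; exact lt_of_le_of_lt hv h1)
  rw [zero_add, dist_comm, dist_eq_norm] at h3
  refine le_of_eq_of_le ?_ h3.le
  congr 2
  rw [Polynomial.eval_finsetSum, FormalMultilinearSeries.partialSum]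
  refine Finset.sum_congr rfl fun k _ => ?_
  rw [FormalMultilinearSeries.apply_eq_pow_smul_coeff]
  rw [smul_eq_mul, Polynomial.eval_mul, Polynomial.eval_C, Polynomial.eval_pow, Polynomial.eval_X]
  exact mul_comm _ _

lemma bet_bound {m : ℕ} (hm : 0 < m) {v : ℂ} (hv : ‖v‖ < 1) {s : ℕ} (hs : s < m) :
    ‖bet m v ^ s‖ ≤ 2 := by
  have h1 : ‖bet m v‖ ^ m ≤ 2 := by
    rw [← norm_pow, bet_pow hm]
    have := norm_add_le (1:ℂ) v
    simp at this; linarith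
  rw [norm_pow]
  rcases le_total ‖bet m v‖ 1 with h | h
  · exact (pow_le_one₀ (norm_nonneg _) h).trans (by norm_num)
  · exact (pow_le_pow_right₀ h hs.le).trans h1

lemma rts_geom {m : ℕ} (hm : 0 < m) {c c0 : ℂ} (hc : c ∈ rts m) (hc0 : c0 ∈ rts m) :
    (m:ℂ)⁻¹ * ∑ s ∈ Finset.range m, (c / c0) ^ s = if c = c0 then 1 else 0 := by
  have h0 : c0 ≠ 0 := by
    rintro rfl
    have := (mem_rts hm).1 hc0
    simp [hm.ne'] at this
  have hm0 : (m:ℂ) ≠ 0 := by exact_mod_cast hm.ne'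
  split_ifs with h
  · subst h
    simp [div_self h0, hm0]
  · have h1 : c / c0 ≠ 1 := by
      intro h'; exact h ((div_eq_one_iff_eq h0).1 h')
    rw [geom_sum_eq h1, div_pow, (mem_rts hm).1 hc, (mem_rts hm).1 hc0]
    simp

lemma rts_norm {m : ℕ} (hm : 0 < m) {c : ℂ} (hc : c ∈ rts m) : ‖c‖ = 1 :=
  Complex.norm_eq_one_of_pow_eq_one ((mem_rts hm).1 hc) hm.ne'

lemma exists_Q {m : ℕ} (hm : 0 < m) {ρ : ℝ} (hρ : 0 < ρ) (hρ1 : ρ < 1) {c0 : ℂ} (hc0 : c0 ∈ rts m)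
    (ε : ℝ) (hε : 0 < ε) :
    ∃ Q : Polynomial ℂ, ∀ c ∈ rts m, ∀ v : ℂ, ‖v‖ ≤ ρ →
      ‖Q.eval (c * bet m v) - if c = c0 then 1 else 0‖ ≤ ε := by
  have hex : ∀ s : ℕ, ∃ g : Polynomial ℂ, ∀ v : ℂ, ‖v‖ ≤ ρ →
      ‖g.eval v - (bet m v ^ s)⁻¹‖ ≤ ε / 2 := by
    intro s
    refine approx_poly hρ hρ1 (fun v => (bet m v ^ s)⁻¹) (fun v hv => ?_) _ (by positivity)
    exact ((bet_deriv m hv).differentiableAt.pow s).inv (pow_ne_zero _ (bet_ne hm hv))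
  choose g hg using hex
  have hm0 : (m:ℂ) ≠ 0 := by exact_mod_cast hm.ne'
  refine ⟨∑ s ∈ Finset.range m, Polynomial.C ((m:ℂ)⁻¹ * (c0⁻¹) ^ s) * Polynomial.X ^ s *
    (g s).comp (Polynomial.X ^ m - 1), fun c hc v hv => ?_⟩
  have hv1 := hv.trans_lt hρ1
  have hb := bet_ne hm hv1
  rw [← rts_geom hm hc hc0, Polynomial.eval_finsetSum, Finset.mul_sum, ← Finset.sum_sub_distrib]
  have : ∀ s ∈ Finset.range m, ‖(Polynomial.C ((m:ℂ)⁻¹ * (c0⁻¹) ^ s) * Polynomial.X ^ s *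
    (g s).comp (Polynomial.X ^ m - 1)).eval (c * bet m v) - (m:ℂ)⁻¹ * (c / c0) ^ s‖
      ≤ (m:ℝ)⁻¹ * ε := by
    intro s hs
    have he : (Polynomial.C ((m:ℂ)⁻¹ * (c0⁻¹) ^ s) * Polynomial.X ^ s *
      (g s).comp (Polynomial.X ^ m - 1)).eval (c * bet m v) - (m:ℂ)⁻¹ * (c / c0) ^ s
      = (m:ℂ)⁻¹ * (c / c0) ^ s * (bet m v ^ s * ((g s).eval v - (bet m v ^ s)⁻¹)) := by
      simp only [Polynomial.eval_mul, Polynomial.eval_C, Polynomial.eval_pow, Polynomial.eval_X,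
        Polynomial.eval_comp, Polynomial.eval_sub, Polynomial.eval_one]
      rw [rts_bet hm hc, mul_sub, mul_inv_cancel₀ (pow_ne_zero _ hb), mul_pow, div_pow, inv_pow]
      ring
    rw [he, norm_mul, norm_mul, norm_mul, norm_pow, norm_div, rts_norm hm hc, rts_norm hm hc0]
    simp only [norm_inv, Complex.norm_natCast, div_one, one_pow, mul_one]
    have h1 := bet_bound hm hv1 (Finset.mem_range.1 hs)
    have h2 := hg s v hv
    gcongr
    calc _ ≤ 2 * (ε / 2) := by gcongr
      _ = ε := by ring
  refine (norm_sum_le_of_le _ this).trans (le_of_eq ?_)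
  have : (m:ℝ) ≠ 0 := by exact_mod_cast hm.ne'
  simp; field_simp

lemma rts_sum {m : ℕ} (hm : 0 < m) (i : ℕ) :
    ∑ c ∈ rts m, c ^ i = if m ∣ i then (m:ℂ) else 0 := by
  have hp := Complex.isPrimitiveRoot_exp m hm.ne'
  set ζ := Complex.exp (2 * Real.pi * Complex.I / m) with hζ
  split_ifs with h
  · obtain ⟨k, rfl⟩ := h
    rw [Finset.sum_congr rfl (g := fun _ => (1:ℂ))]
    · simp [rts, hp.card_nthRootsFinset]
    · intro c hc
      rw [pow_mul, (mem_rts hm).1 hc, one_pow]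
  · have h1 : ζ ^ i ≠ 1 := fun h' => h ((hp.pow_eq_one_iff_dvd i).1 h')
    have hz0 : ζ ≠ 0 := hp.ne_zero hm.ne'
    have h2 : ∑ c ∈ rts m, c ^ i = ∑ c ∈ rts m, (ζ * c) ^ i := by
      symm
      refine Finset.sum_bij (fun d _ => ζ * d) ?_ ?_ ?_ ?_
      · intro d hd
        rw [mem_rts hm] at *
        rw [mul_pow, hd, hp.pow_eq_one, one_mul]
      · intro d _ d' _ h
        exact mul_left_cancel₀ hz0 h
      · intro d hd
        refine ⟨d / ζ, ?_, by field_simp⟩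
        rw [mem_rts hm] at *
        rw [div_pow, hd, hp.pow_eq_one, div_one]
      · intro d _
        rfl
    simp_rw [mul_pow] at h2
    rw [← Finset.mul_sum] at h2
    have : (1 - ζ ^ i) * ∑ c ∈ rts m, c ^ i = 0 := by linear_combination h2
    rcases mul_eq_zero.1 this with h3 | h3
    · exact absurd (by linear_combination -h3) h1
    · exact h3

lemma extract {m : ℕ} (hm : 0 < m) (R : Polynomial ℂ) (D : ℕ) (hR : R.natDegree ≤ D) :
    ∃ p : Polynomial ℂ, p.natDegree ≤ D / m ∧
      ∀ z : ℂ, ∑ c ∈ rts m, c * R.eval (c * z) = m * z ^ (m - 1) * p.eval (z ^ m - 1) := by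
  refine ⟨∑ i ∈ Finset.range (D + 1), if m ∣ i + 1 then
    Polynomial.C (R.coeff i) * (Polynomial.X + 1) ^ ((i + 1) / m - 1) else 0, ?_, fun z => ?_⟩
  · refine Polynomial.natDegree_sum_le_of_forall_le _ _ fun i hi => ?_
    split_ifs with h
    · refine (Polynomial.natDegree_C_mul_le _ _).trans ?_
      refine (Polynomial.natDegree_pow_le).trans ?_
      have h1 : (Polynomial.X + 1 : Polynomial ℂ).natDegree ≤ 1 := by
        simpa using (Polynomial.natDegree_X_add_C (1:ℂ)).le
      obtain ⟨k, hk⟩ := h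
      rw [hk, Nat.mul_div_cancel_left _ hm]
      have hk1 : 1 ≤ k := by
        rcases Nat.eq_zero_or_pos k with h | h
        · subst h; simp at hk
        · exact h
      obtain ⟨l, rfl⟩ := Nat.exists_eq_add_of_le' hk1
      have hiD : i < D + 1 := Finset.mem_range.1 hi
      have : l ≤ D / m := by
        rw [Nat.le_div_iff_mul_le hm]
        have : m * (l + 1) = l * m + m := by ring
        omega
      calc _ ≤ l * 1 := by gcongr; omega
        _ ≤ _ := by omega
    · simp
  · simp_rw [Polynomial.eval_eq_sum_range' (Nat.lt_succ_of_le hR)]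
    simp_rw [Finset.mul_sum]
    rw [Finset.sum_comm, Polynomial.eval_finsetSum, Finset.mul_sum]
    refine Finset.sum_congr rfl fun i _ => ?_
    have h1 : ∀ c : ℂ, c * (R.coeff i * (c * z) ^ i) = (R.coeff i * z ^ i) * c ^ (i + 1) := by
      intro c; rw [mul_pow]; ring
    simp_rw [h1]
    rw [← Finset.mul_sum, rts_sum hm]
    split_ifs with h
    · obtain ⟨k, hk⟩ := h
      rw [hk, Nat.mul_div_cancel_left _ hm]
      have hk1 : 1 ≤ k := by
        rcases Nat.eq_zero_or_pos k with h | h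
        · subst h; simp at hk
        · exact h
      obtain ⟨l, rfl⟩ := Nat.exists_eq_add_of_le' hk1
      have : i = m - 1 + m * l := by
        have : m * (l + 1) = m * l + m := by ring
        omega
      simp only [Polynomial.eval_mul, Polynomial.eval_C, Polynomial.eval_pow, Polynomial.eval_add,
        Polynomial.eval_X, Polynomial.eval_one, sub_add_cancel, Nat.add_sub_cancel]
      conv_lhs => rw [this]
      rw [pow_add, pow_mul, ← this]
      ring
    · simp


lemma rts_card {m : ℕ} (hm : 0 < m) : (rts m).card = m := by
  have := rts_sum hm 0
  simp at this
  exact_mod_cast this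

lemma bker_nonneg {ρ : ℝ} (hρ : 0 < ρ) (M : ℕ) (x : ℂ) : 0 ≤ (bker ρ M x x).re := by
  rw [bker_diag]
  have := Real.pi_pos
  exact Finset.sum_nonneg fun k _ => by positivity

lemma rker_nonneg (φ : ℕ → Polynomial ℂ) (n : ℕ) (x : ℂ) : 0 ≤ (repKernel φ n x x).re := by
  rw [aux_ker_diag]
  exact Finset.sum_nonneg fun k _ => by positivity

/-- `Q` approximates the indicator function of the component belonging to `c0` -/
def GoodQ (m : ℕ) (ρ : ℝ) (c0 : ℂ) (ε : ℝ) (Q : Polynomial ℂ) : Prop :=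
  ∀ c ∈ rts m, ∀ v : ℂ, ‖v‖ ≤ ρ → ‖Q.eval (c * bet m v) - if c = c0 then 1 else 0‖ ≤ ε

lemma GoodQ.bound {m : ℕ} {ρ : ℝ} {c0 : ℂ} {ε : ℝ} {Q : Polynomial ℂ} (h : GoodQ m ρ c0 ε Q)
    {c : ℂ} (hc : c ∈ rts m) {v : ℂ} (hv : ‖v‖ ≤ ρ) :
    ‖Q.eval (c * bet m v)‖ ≤ (if c = c0 then 1 else 0) + ε := by
  have h1 := h c hc v hv
  have h2 := norm_add_le (Q.eval (c * bet m v) - if c = c0 then 1 else 0)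
    (if c = c0 then 1 else 0)
  rw [sub_add_cancel] at h2
  refine h2.trans ?_
  rw [add_comm]
  gcongr
  split_ifs <;> simp

section
variable {m : ℕ} (hm : 0 < m) {r : ℝ} (hρ : 0 < r ^ m) (hρ1 : r ^ m < 1)
  {φ : ℕ → Polynomial ℂ} {κ : ℕ → ℝ}
  (hON : IsOrthonormalPolys (volume.restrict (lemniscate r m)) φ κ)
  {c0 : ℂ} (hc0 : c0 ∈ rts m) {ε : ℝ} (hε : 0 < ε) (hε1 : ε ≤ 1) {Q : Polynomial ℂ}
  (hQ : GoodQ m (r ^ m) c0 ε Q)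

include hm hρ1 hc0 hε hε1 hQ in
lemma upper_norm (P p : Polynomial ℂ)
    (hp : ∀ z : ℂ, ∑ c ∈ rts m, c * (P * Q).eval (c * z)
      = m * z ^ (m - 1) * p.eval (z ^ m - 1)) :
    ∫ v in Metric.ball (0:ℂ) (r ^ m), ‖p.eval v‖ ^ 2
      ≤ (1 + (2 * m + 1) * ε) * ∫ z in lemniscate r m, ‖P.eval z‖ ^ 2 := by
  have hcov := lem_cov hm hρ1 (fun z => ‖P.eval z‖ ^ 2) (by fun_prop)
  rw [hcov.2, ← integral_const_mul]
  refine setIntegral_mono_on (aux_int_ball _ _ (by fun_prop))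
    ((integrable_finsetSum _ hcov.1).const_mul _) Metric.isOpen_ball.measurableSet fun v hv => ?_
  rw [mem_ball_zero_iff] at hv
  have hv1 := hv.trans hρ1
  have hpv : p.eval v = dbet m v * ∑ c ∈ rts m, c * (P * Q).eval (c * bet m v) := by
    have hb := bet_dbet hm hv1
    rw [hp, bet_pow hm, add_sub_cancel_left]
    linear_combination -p.eval v * hb
  set y : ℂ → ℝ := fun c => ‖P.eval (c * bet m v)‖ with hy
  have hy0 : ∀ c, 0 ≤ y c := fun c => norm_nonneg _
  have h1 : ‖p.eval v‖ ≤ ‖dbet m v‖ * (y c0 + ε * ∑ c ∈ rts m, y c) := by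
    rw [hpv, norm_mul]
    gcongr
    have h2 : ∀ c ∈ rts m, ‖c * (P * Q).eval (c * bet m v)‖
        ≤ (if c = c0 then y c else 0) + ε * y c := by
      intro c hc
      rw [norm_mul, rts_norm hm hc, one_mul, Polynomial.eval_mul, norm_mul]
      calc _ ≤ y c * ((if c = c0 then 1 else 0) + ε) := by
            gcongr
            exact hQ.bound hc hv.le
        _ = _ := by split_ifs <;> ring
    refine (norm_sum_le_of_le _ h2).trans (le_of_eq ?_)
    rw [Finset.sum_add_distrib, Finset.sum_ite_eq', if_pos hc0, Finset.mul_sum]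
  have hS : (∑ c ∈ rts m, y c) ^ 2 ≤ m * ∑ c ∈ rts m, y c ^ 2 := by
    have := sq_sum_le_card_mul_sum_sq (s := rts m) (f := y)
    rwa [rts_card hm] at this
  have hy1 : y c0 ^ 2 ≤ ∑ c ∈ rts m, y c ^ 2 :=
    Finset.single_le_sum (f := fun c => y c ^ 2) (fun c _ => sq_nonneg _) hc0
  set S := ∑ c ∈ rts m, y c
  set T := ∑ c ∈ rts m, y c ^ 2
  have h3 : (y c0 + ε * S) ^ 2 ≤ (1 + (2 * m + 1) * ε) * T := by
    have e1 : (y c0 + ε * S) ^ 2 ≤ (1 + ε) * y c0 ^ 2 + (ε + ε ^ 2) * S ^ 2 := by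
      nlinarith [mul_nonneg hε.le (sq_nonneg (y c0 - S))]
    have e2 : (1 + ε) * y c0 ^ 2 ≤ (1 + ε) * T := by gcongr
    have e3 : (ε + ε ^ 2) * S ^ 2 ≤ (2 * ε) * (m * T) := by
      have : ε + ε ^ 2 ≤ 2 * ε := by nlinarith
      gcongr
    linarith
  calc ‖p.eval v‖ ^ 2 ≤ (‖dbet m v‖ * (y c0 + ε * S)) ^ 2 := by gcongr
    _ = ‖dbet m v‖ ^ 2 * (y c0 + ε * S) ^ 2 := by ring
    _ ≤ ‖dbet m v‖ ^ 2 * ((1 + (2 * m + 1) * ε) * T) := by gcongr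
    _ = _ := by
      rw [← Finset.mul_sum]
      ring

include hm hρ hρ1 hON hc0 hε hε1 hQ in
lemma upper_bound (n : ℕ) (w : ℂ)
    (hτ : 0 ≤ ‖Q.eval w‖ - ∑ c ∈ (rts m).erase 1, ‖Q.eval (c * w)‖) :
    (repKernel φ n w w).re * (‖Q.eval w‖ - ∑ c ∈ (rts m).erase 1, ‖Q.eval (c * w)‖) ^ 2
      ≤ (1 + (2 * m + 1) * ε) * (m * ‖w‖ ^ (m - 1)) ^ 2 *
        (bker (r ^ m) ((n + Q.natDegree) / m) (w ^ m - 1) (w ^ m - 1)).re := by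
  have hint : ∀ f : ℂ → ℂ, Continuous f → Integrable f (volume.restrict (lemniscate r m)) :=
    fun f hf => lem_int hm hρ1 f hf
  obtain ⟨P, hPd, hPw, hPn⟩ := aux_kerpoly hON hint n w
  set D := (repKernel φ n w w).re with hD
  have hD0 : 0 ≤ D := rker_nonneg _ _ _
  obtain ⟨p, hpd, hp⟩ := extract hm (P * Q) (n + Q.natDegree)
    (Polynomial.natDegree_mul_le.trans (by omega))
  have hn := upper_norm hm hρ1 hc0 hε hε1 hQ P p hp
  rw [hPn] at hn
  have hb := bker_point (r ^ m) hρ _ p hpd (w ^ m - 1)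
  set B := (bker (r ^ m) ((n + Q.natDegree) / m) (w ^ m - 1) (w ^ m - 1)).re with hB
  have hB0 : 0 ≤ B := bker_nonneg hρ _ _
  set τ := ‖Q.eval w‖ - ∑ c ∈ (rts m).erase 1, ‖Q.eval (c * w)‖ with hτd
  have hPc : ∀ c ∈ rts m, ‖P.eval (c * w)‖ ≤ D := by
    intro c hc
    have h1 := aux_point hON hint n (P.comp (Polynomial.C c * Polynomial.X))
      ((Polynomial.natDegree_comp_le).trans (by
        have : (Polynomial.C c * Polynomial.X).natDegree ≤ 1 := ((Polynomial.natDegree_C_mul_le _ _).trans Polynomial.natDegree_X_le)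
        calc _ ≤ P.natDegree * 1 := by gcongr
          _ ≤ n := by omega)) w
    simp only [Polynomial.eval_comp, Polynomial.eval_mul, Polynomial.eval_C, Polynomial.eval_X] at h1
    rw [lem_rot hm hρ1 (fun z => ‖P.eval z‖ ^ 2) (by fun_prop) hc, hPn, ← pow_two] at h1
    exact (pow_le_pow_iff_left₀ (norm_nonneg _) hD0 two_ne_zero).1 h1
  have h1m : (1:ℂ) ∈ rts m := by rw [mem_rts hm]; simp
  have hval : D * τ ≤ m * ‖w‖ ^ (m - 1) * ‖p.eval (w ^ m - 1)‖ := by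
    have e1 : m * ‖w‖ ^ (m - 1) * ‖p.eval (w ^ m - 1)‖
        = ‖∑ c ∈ rts m, c * (P * Q).eval (c * w)‖ := by
      rw [hp]; simp
    rw [e1, ← Finset.add_sum_erase _ _ h1m]
    have e2 : ‖∑ c ∈ (rts m).erase 1, c * (P * Q).eval (c * w)‖
        ≤ ∑ c ∈ (rts m).erase 1, D * ‖Q.eval (c * w)‖ := by
      refine norm_sum_le_of_le _ fun c hc => ?_
      have hc' := Finset.mem_of_mem_erase hc
      rw [norm_mul, rts_norm hm hc', one_mul, Polynomial.eval_mul, norm_mul]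
      gcongr
      exact hPc c hc'
    have e3 : ‖(1:ℂ) * (P * Q).eval (1 * w)‖ = D * ‖Q.eval w‖ := by
      rw [one_mul, one_mul, Polynomial.eval_mul, norm_mul, hPw, Complex.norm_real,
        Real.norm_of_nonneg hD0]
    have e4 := norm_sub_le ((1:ℂ) * (P * Q).eval (1 * w) +
      ∑ c ∈ (rts m).erase 1, c * (P * Q).eval (c * w))
      (∑ c ∈ (rts m).erase 1, c * (P * Q).eval (c * w))
    rw [add_sub_cancel_right, e3] at e4
    rw [hτd, mul_sub, Finset.mul_sum]
    linarith
  have hsq : (D * τ) ^ 2 ≤ D * ((1 + (2 * m + 1) * ε) * (m * ‖w‖ ^ (m - 1)) ^ 2 * B) := by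
    calc (D * τ) ^ 2 ≤ (m * ‖w‖ ^ (m - 1) * ‖p.eval (w ^ m - 1)‖) ^ 2 := by
          gcongr
      _ = (m * ‖w‖ ^ (m - 1)) ^ 2 * ‖p.eval (w ^ m - 1)‖ ^ 2 := by ring
      _ ≤ (m * ‖w‖ ^ (m - 1)) ^ 2 * (B * ((1 + (2 * m + 1) * ε) * D)) := by
          gcongr
          exact hb.trans (by gcongr)
      _ = _ := by ring
  rcases hD0.eq_or_lt with h | h
  · rw [← h]
    simp only [zero_mul]
    positivity
  · refine le_of_mul_le_mul_left ?_ h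
    calc _ = (D * τ) ^ 2 := by ring
      _ ≤ _ := hsq

include hm hρ hρ1 hc0 hε hε1 hQ in
lemma trial_exists (N : ℕ) (w' : ℂ) :
    ∃ F : Polynomial ℂ, F.natDegree ≤ (m - 1) + Q.natDegree + m * N ∧
      (∀ z, F.eval z = m ^ 2 * (z ^ (m - 1) * Q.eval z) * conj (w' ^ (m - 1) * Q.eval w') *
        bker (r ^ m) N (z ^ m - 1) (w' ^ m - 1)) ∧
      ∫ z in lemniscate r m, ‖F.eval z‖ ^ 2 ≤ (1 + (m + 2) * ε) *
        (m ^ 2 * ‖w' ^ (m - 1) * Q.eval w'‖ ^ 2 * (bker (r ^ m) N (w' ^ m - 1) (w' ^ m - 1)).re) := by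
  set t : ℂ := w' ^ (m - 1) * Q.eval w' with ht
  set v' : ℂ := w' ^ m - 1 with hv'
  let k : Polynomial ℂ := ∑ k ∈ Finset.range (N + 1),
    Polynomial.C ((((k + 1) / (Real.pi * (r ^ m) ^ (2 * k + 2)) : ℝ) : ℂ) * conj v' ^ k) *
      (Polynomial.X ^ m - 1) ^ k
  have hk : ∀ z, k.eval z = bker (r ^ m) N (z ^ m - 1) v' := by
    intro z
    simp only [k, Polynomial.eval_finsetSum, bker]
    refine Finset.sum_congr rfl fun i _ => ?_
    simp only [Polynomial.eval_mul, Polynomial.eval_C, Polynomial.eval_pow, Polynomial.eval_X,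
      Polynomial.eval_sub, Polynomial.eval_one]
    rw [mul_pow]; ring
  have hkd : k.natDegree ≤ m * N := by
    refine Polynomial.natDegree_sum_le_of_forall_le _ _ fun i hi => ?_
    refine (Polynomial.natDegree_C_mul_le _ _).trans ?_
    refine (Polynomial.natDegree_pow_le).trans ?_
    have h1 : (Polynomial.X ^ m - 1 : Polynomial ℂ).natDegree ≤ m := by
      simpa using (Polynomial.natDegree_X_pow_sub_C (n := m) (r := (1:ℂ))).le
    have h2 : i ≤ N := by have := Finset.mem_range.1 hi; omega
    calc _ ≤ N * m := by gcongr
      _ = m * N := by ring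
  have hF : ∀ z, (Polynomial.C ((m:ℂ) ^ 2 * conj t) * Polynomial.X ^ (m - 1) * Q * k).eval z
      = m ^ 2 * (z ^ (m - 1) * Q.eval z) * conj t * bker (r ^ m) N (z ^ m - 1) v' := by
    intro z
    simp only [Polynomial.eval_mul, Polynomial.eval_C, Polynomial.eval_pow, Polynomial.eval_X, hk]
    ring
  refine ⟨Polynomial.C ((m:ℂ) ^ 2 * conj t) * Polynomial.X ^ (m - 1) * Q * k, ?_, hF, ?_⟩
  · refine (Polynomial.natDegree_mul_le).trans (add_le_add ?_ hkd)
    refine (Polynomial.natDegree_mul_le).trans (add_le_add ?_ le_rfl)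
    exact Polynomial.natDegree_C_mul_X_pow_le _ _
  · have hcov := lem_cov hm hρ1 (fun z => ‖(Polynomial.C ((m:ℂ) ^ 2 * conj t) *
      Polynomial.X ^ (m - 1) * Q * k).eval z‖ ^ 2) (by fun_prop)
    rw [hcov.2, ← bker_norm (r ^ m) hρ, ← mul_assoc, ← integral_const_mul]
    have hcb : Continuous fun v => bker (r ^ m) N v v' := by
      unfold bker; fun_prop
    refine setIntegral_mono_on (integrable_finsetSum _ hcov.1)
      ((aux_int_ball _ _ (by fun_prop)).const_mul _) Metric.isOpen_ball.measurableSet fun v hv => ?_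
    rw [mem_ball_zero_iff] at hv
    have hv1 := hv.trans hρ1
    have h1 : ∀ c ∈ rts m, ‖dbet m v‖ ^ 2 * ‖(Polynomial.C ((m:ℂ) ^ 2 * conj t) *
        Polynomial.X ^ (m - 1) * Q * k).eval (c * bet m v)‖ ^ 2
        = (m ^ 2 * ‖t‖ ^ 2 * ‖bker (r ^ m) N v v'‖ ^ 2) * ‖Q.eval (c * bet m v)‖ ^ 2 := by
      intro c hc
      have hd := norm_dbet hm hv1
      rw [hF, rts_bet hm hc]
      simp only [norm_mul, norm_pow, rts_norm hm hc, one_mul, Complex.norm_natCast, RCLike.norm_conj]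
      calc _ = (m * ‖bet m v‖ ^ (m - 1) * ‖dbet m v‖) ^ 2 *
            ((m ^ 2 * ‖t‖ ^ 2 * ‖bker (r ^ m) N v v'‖ ^ 2) * ‖Q.eval (c * bet m v)‖ ^ 2) := by ring
        _ = _ := by rw [hd]; ring
    rw [Finset.sum_congr rfl h1, ← Finset.mul_sum]
    have h2 : ∑ c ∈ rts m, ‖Q.eval (c * bet m v)‖ ^ 2 ≤ 1 + (m + 2) * ε := by
      calc _ ≤ ∑ c ∈ rts m, ((if c = c0 then (1 + 2 * ε) else 0) + ε ^ 2) := by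
            refine Finset.sum_le_sum fun c hc => ?_
            have := hQ.bound hc hv.le
            calc _ ≤ ((if c = c0 then 1 else 0) + ε) ^ 2 := by gcongr
              _ = _ := by split_ifs <;> ring
        _ = 1 + 2 * ε + m * ε ^ 2 := by
            rw [Finset.sum_add_distrib, Finset.sum_ite_eq', if_pos hc0, Finset.sum_const,
              rts_card hm, nsmul_eq_mul]
        _ ≤ _ := by
            have : (m:ℝ) * ε ^ 2 ≤ m * ε := by gcongr; nlinarith
            linarith
    calc _ ≤ (m ^ 2 * ‖t‖ ^ 2 * ‖bker (r ^ m) N v v'‖ ^ 2) * (1 + (m + 2) * ε) := by gcongr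
      _ = _ := by ring

include hm hρ hρ1 hON hc0 hε hε1 hQ in
lemma comb (n N : ℕ) (hN : (m - 1) + Q.natDegree + m * N ≤ n) (w w' : ℂ) :
    ‖m ^ 2 * (w ^ (m - 1) * Q.eval w) * conj (w' ^ (m - 1) * Q.eval w') *
        bker (r ^ m) N (w ^ m - 1) (w' ^ m - 1) - repKernel φ n w w'‖ ^ 2
      ≤ (repKernel φ n w w).re * ((repKernel φ n w' w').re - (1 - (m + 2) * ε) *
        (m ^ 2 * ‖w' ^ (m - 1) * Q.eval w'‖ ^ 2 *
          (bker (r ^ m) N (w' ^ m - 1) (w' ^ m - 1)).re)) := by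
  obtain ⟨F, hFd, hF, hFn⟩ := trial_exists hm hρ hρ1 hc0 hε hε1 hQ N w'
  have h := aux_trial hON (fun f hf => lem_int hm hρ1 f hf) n F (hFd.trans hN) w w'
  rw [hF] at h
  refine h.trans ?_
  refine mul_le_mul_of_nonneg_left ?_ (rker_nonneg _ _ _)
  have : (F.eval w').re = m ^ 2 * ‖w' ^ (m - 1) * Q.eval w'‖ ^ 2 *
          (bker (r ^ m) N (w' ^ m - 1) (w' ^ m - 1)).re := by
    rw [hF, mul_assoc ((m:ℂ) ^ 2), Complex.mul_conj']
    rw [← Complex.ofReal_natCast, ← Complex.ofReal_pow, ← Complex.ofReal_pow, ← Complex.ofReal_mul,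
      Complex.re_ofReal_mul]
  rw [this]
  linarith
end


lemma Hfun_zero : Hfun 0 = 1 := by simp [Hfun]

lemma Hfun_continuous : Continuous Hfun := by
  rw [continuous_iff_continuousAt]
  intro t
  rcases eq_or_ne t 0 with rfl | ht
  · have hb : ∀ᶠ t : ℂ in 𝓝 0, ‖Hfun t - 1‖ ≤ 5 * ‖t‖ := by
      filter_upwards [Metric.ball_mem_nhds (0:ℂ) one_pos] with t ht
      rw [mem_ball_zero_iff] at ht
      rcases eq_or_ne t 0 with rfl | h0
      · simp [Hfun]
      have h3 := Complex.exp_bound ht.le (n := 3) (by norm_num)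
      simp [Finset.sum_range_succ, Nat.factorial] at h3
      set R := Complex.exp t - (1 + t + t ^ 2 / 2) with hR
      have e : Hfun t - 1 = t + 2 * R * (t - 1) / t ^ 2 := by
        rw [Hfun, if_neg h0, hR]
        field_simp
        ring
      rw [e]
      have h4 : ‖2 * R * (t - 1) / t ^ 2‖ ≤ 4 * ‖t‖ := by
        rw [norm_div, norm_mul, norm_mul, norm_pow, div_le_iff₀ (by positivity)]
        have h5 : ‖t - 1‖ ≤ 2 := (norm_sub_le _ _).trans (by simp; linarith)
        have h6 : ‖R‖ ≤ ‖t‖ ^ 3 := h3.trans (by nlinarith [pow_pos (norm_pos_iff.2 h0) 3])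
        calc ‖(2:ℂ)‖ * ‖R‖ * ‖t - 1‖ ≤ 2 * ‖t‖ ^ 3 * 2 := by
              simp only [Complex.norm_ofNat]; gcongr
          _ = _ := by ring
      exact (norm_add_le _ _).trans (by linarith)
    rw [ContinuousAt, Hfun_zero, tendsto_iff_norm_sub_tendsto_zero]
    refine squeeze_zero' (Eventually.of_forall fun _ => norm_nonneg _) hb ?_
    have : Continuous fun t : ℂ => 5 * ‖t‖ := by fun_prop
    simpa using this.tendsto 0
  · have : (fun t => 2 * (Complex.exp t * (t - 1) + 1) / t ^ 2) =ᶠ[𝓝 t] Hfun := by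
      filter_upwards [isOpen_ne.mem_nhds ht] with s hs
      rw [Hfun, if_neg hs]
    refine ContinuousAt.congr ?_ this
    have : t ^ 2 ≠ 0 := pow_ne_zero _ ht
    fun_prop (disch := assumption)

lemma geom_closed (q : ℂ) (L : ℕ) :
    (q - 1) ^ 2 * ∑ k ∈ Finset.range L, ((k:ℂ) + 1) * q ^ k = q ^ L * (L * (q - 1) - 1) + 1 := by
  induction L with
  | zero => simp
  | succ L ih => rw [Finset.sum_range_succ, mul_add, ih]; push_cast; ring

lemma pow_sub_one_le (q : ℂ) (k : ℕ) : ‖q ^ k - 1‖ ≤ Real.exp (k * ‖q - 1‖) - 1 := by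
  induction k with
  | zero => simp
  | succ k ih =>
    have e : q ^ (k + 1) - 1 = (1 + (q - 1)) * (q ^ k - 1) + (q - 1) := by ring
    have h1 : ‖1 + (q - 1)‖ ≤ 1 + ‖q - 1‖ := (norm_add_le _ _).trans (by simp)
    have h2 : 1 + ‖q - 1‖ ≤ Real.exp ‖q - 1‖ := by linarith [Real.add_one_le_exp ‖q - 1‖]
    rw [e]
    calc _ ≤ (1 + ‖q - 1‖) * (Real.exp (k * ‖q - 1‖) - 1) + ‖q - 1‖ := by
          refine (norm_add_le _ _).trans ?_
          rw [norm_mul]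
          gcongr
      _ = (1 + ‖q - 1‖) * Real.exp (k * ‖q - 1‖) - 1 := by ring
      _ ≤ Real.exp ‖q - 1‖ * Real.exp (k * ‖q - 1‖) - 1 := by gcongr
      _ = _ := by rw [← Real.exp_add]; push_cast; ring_nf

lemma pow_lim {ι : Type*} {l : Filter ι} {L : ι → ℕ} {q : ι → ℂ} {A : ℂ}
    (hL : Tendsto L l atTop) (hq : Tendsto (fun i => (L i : ℂ) * (q i - 1)) l (𝓝 A)) :
    Tendsto (fun i => q i ^ L i) l (𝓝 (Complex.exp A)) := by
  have hLc : Tendsto (fun i => ((L i : ℂ))⁻¹) l (𝓝 0) :=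
    (tendsto_inv_atTop_nhds_zero_nat (𝕜 := ℂ)).comp hL
  have hL0 : ∀ᶠ i in l, L i ≠ 0 := hL.eventually (eventually_ne_atTop 0)
  have hq1 : Tendsto q l (𝓝 1) := by
    have : Tendsto (fun i => ((L i : ℂ))⁻¹ * (L i * (q i - 1)) + 1) l (𝓝 (0 * A + 1)) :=
      (hLc.mul hq).add tendsto_const_nhds
    rw [zero_mul, zero_add] at this
    refine this.congr' ?_
    filter_upwards [hL0] with i hi
    have : (L i : ℂ) ≠ 0 := by exact_mod_cast hi
    field_simp
    ring
  have hd : HasDerivAt Complex.log 1 1 := by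
    simpa using Complex.hasDerivAt_log (z := 1) (by simp)
  have hc : Tendsto (fun i => dslope Complex.log 1 (q i)) l (𝓝 1) := by
    have := (continuousAt_dslope_same.2 hd.differentiableAt).tendsto
    rw [dslope_same, hd.deriv] at this
    exact this.comp hq1
  have hlim := (Complex.continuous_exp.tendsto _).comp (hq.mul hc)
  rw [mul_one] at hlim
  refine hlim.congr' ?_
  filter_upwards [hq1.eventually (isOpen_ne.mem_nhds (one_ne_zero))] with i hi
  simp only [Function.comp_apply]
  have h := sub_smul_dslope Complex.log 1 (q i)
  simp only [smul_eq_mul, Complex.log_one, sub_zero] at h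
  rw [mul_assoc, h, Complex.exp_nat_mul, Complex.exp_log hi]

lemma sum_lim {ι : Type*} {l : Filter ι} {L : ι → ℕ} {q : ι → ℂ} {A : ℂ}
    (hL : Tendsto L l atTop) (hq : Tendsto (fun i => (L i : ℂ) * (q i - 1)) l (𝓝 A)) :
    Tendsto (fun i => (∑ k ∈ Finset.range (L i), ((k:ℂ) + 1) * q i ^ k) / (L i : ℂ) ^ 2) l
      (𝓝 (Hfun A / 2)) := by
  have hL0 : ∀ᶠ i in l, L i ≠ 0 := hL.eventually (eventually_ne_atTop 0)
  rcases eq_or_ne A 0 with rfl | hA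
  · rw [Hfun_zero]
    have hLc : Tendsto (fun i => ((L i : ℂ))⁻¹) l (𝓝 0) :=
      (tendsto_inv_atTop_nhds_zero_nat (𝕜 := ℂ)).comp hL
    have h1 : Tendsto (fun i => (1 + ((L i : ℂ))⁻¹) / 2) l (𝓝 (1 / 2)) := by
      have := (hLc.const_add 1).div_const 2
      simpa using this
    have h2 : Tendsto (fun i => (∑ k ∈ Finset.range (L i), ((k:ℂ) + 1) * (q i ^ k - 1))
        / (L i : ℂ) ^ 2) l (𝓝 0) := by
      have hd : Tendsto (fun i => Real.exp ‖(L i : ℂ) * (q i - 1)‖ - 1) l (𝓝 0) := by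
        have := ((Real.continuous_exp.tendsto _).comp hq.norm).sub_const 1
        simpa using this
      refine squeeze_zero_norm' ?_ hd
      filter_upwards [hL0] with i hi
      have hi' : (0:ℝ) < L i := by exact_mod_cast Nat.pos_of_ne_zero hi
      rw [norm_div, norm_pow, Complex.norm_natCast, div_le_iff₀ (by positivity)]
      have : ∀ k ∈ Finset.range (L i), ‖((k:ℂ) + 1) * (q i ^ k - 1)‖
          ≤ (L i : ℝ) * (Real.exp ‖(L i : ℂ) * (q i - 1)‖ - 1) := by
        intro k hk
        have hk : k + 1 ≤ L i := Finset.mem_range.1 hk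
        rw [norm_mul, norm_mul, Complex.norm_natCast]
        have e : ‖(k:ℂ) + 1‖ = ((k + 1 : ℕ) : ℝ) := by
          rw [← Complex.norm_natCast]; push_cast; rfl
        rw [e]
        have h5 : ((k + 1 : ℕ) : ℝ) ≤ L i := by exact_mod_cast hk
        have h6 : (k:ℝ) ≤ L i := by exact_mod_cast (by omega : k ≤ L i)
        have h7 := pow_sub_one_le (q i) k
        have h8 : Real.exp (k * ‖q i - 1‖) ≤ Real.exp (L i * ‖q i - 1‖) := by gcongr
        exact mul_le_mul h5 (by linarith) (norm_nonneg _) hi'.le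
      refine (norm_sum_le_of_le _ this).trans ?_
      rw [Finset.sum_const, Finset.card_range, nsmul_eq_mul]
      exact le_of_eq (by ring)
    have h3 := h1.add h2
    rw [add_zero] at h3
    refine h3.congr' ?_
    filter_upwards [hL0] with i hi
    have hi' : (L i : ℂ) ≠ 0 := by exact_mod_cast hi
    have e : ∀ n : ℕ, ∑ k ∈ Finset.range n, ((k:ℂ) + 1) = n * (n + 1) / 2 := by
      intro n
      induction n with
      | zero => simp
      | succ n ih => rw [Finset.sum_range_succ, ih]; push_cast; ring
    simp_rw [mul_sub, mul_one]
    rw [Finset.sum_sub_distrib, e]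
    field_simp
    ring
  · have h := ((pow_lim hL hq).mul (hq.sub_const 1)).add_const 1 |>.div (hq.pow 2) (pow_ne_zero _ hA)
    have e : Hfun A / 2 = (Complex.exp A * (A - 1) + 1) / A ^ 2 := by
      rw [Hfun, if_neg hA]; ring
    rw [e]
    refine h.congr' ?_
    filter_upwards [hL0, hq.eventually (isOpen_ne.mem_nhds hA)] with i hi hi2
    have hi' : (L i : ℂ) ≠ 0 := by exact_mod_cast hi
    have hq' : q i - 1 ≠ 0 := right_ne_zero_of_mul hi2
    have := geom_closed (q i) (L i)
    simp only [Pi.div_apply]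
    rw [← this]
    field_simp

lemma bker_lim {ι : Type*} {l : Filter ι} {ρ : ℝ} (hρ : 0 < ρ) {m : ℕ} (hm : 0 < m)
    {n M : ι → ℕ} {x y : ι → ℂ} {A : ℂ}
    (hn : Tendsto n l atTop) (hM : Tendsto (fun i => (M i : ℂ) / n i) l (𝓝 (1 / m)))
    (hq : Tendsto (fun i => (n i : ℂ) * (x i * conj (y i) / ρ ^ 2 - 1)) l (𝓝 (m * A))) :
    Tendsto (fun i => bker ρ (M i) (x i) (y i) / (n i : ℂ) ^ 2) l
      (𝓝 (Hfun A / (2 * Real.pi * ρ ^ 2 * m ^ 2))) := by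
  have hm0 : (m:ℂ) ≠ 0 := by exact_mod_cast hm.ne'
  have hρ0 : (ρ:ℂ) ≠ 0 := by exact_mod_cast hρ.ne'
  have hpi : (Real.pi:ℂ) ≠ 0 := by exact_mod_cast Real.pi_ne_zero
  have hn0 : ∀ᶠ i in l, n i ≠ 0 := hn.eventually (eventually_ne_atTop 0)
  have hnc : Tendsto (fun i => ((n i : ℂ))⁻¹) l (𝓝 0) :=
    (tendsto_inv_atTop_nhds_zero_nat (𝕜 := ℂ)).comp hn
  have hL : Tendsto (fun i => ((M i + 1 : ℕ) : ℂ) / n i) l (𝓝 (1 / m)) := by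
    have := hM.add hnc
    rw [add_zero] at this
    refine this.congr fun i => ?_
    push_cast; ring
  have hLT : Tendsto (fun i => M i + 1) l atTop := by
    have h1 : Tendsto (fun i => ‖((M i + 1 : ℕ) : ℂ) / n i‖ * (n i : ℝ)) l atTop := by
      refine hL.norm.pos_mul_atTop ?_ (tendsto_natCast_atTop_atTop.comp hn)
      exact norm_pos_iff.2 (by simpa using hm0)
    have h2 : Tendsto (fun i => ((M i + 1 : ℕ) : ℝ)) l atTop := by
      refine h1.congr' ?_
      filter_upwards [hn0] with i hi
      have : (n i : ℝ) ≠ 0 := by exact_mod_cast hi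
      rw [norm_div, Complex.norm_natCast, Complex.norm_natCast]
      field_simp
    exact tendsto_natCast_atTop_iff.1 h2
  have hLq : Tendsto (fun i => ((M i + 1 : ℕ) : ℂ) * (x i * conj (y i) / ρ ^ 2 - 1)) l (𝓝 A) := by
    have := hL.mul hq
    rw [show (1 / (m:ℂ)) * (m * A) = A by field_simp] at this
    refine this.congr' ?_
    filter_upwards [hn0] with i hi
    have : (n i : ℂ) ≠ 0 := by exact_mod_cast hi
    field_simp
  have h := ((sum_lim hLT hLq).mul (hL.pow 2)).div_const ((Real.pi : ℂ) * ρ ^ 2)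
  rw [show Hfun A / 2 * (1 / (m:ℂ)) ^ 2 / (Real.pi * ρ ^ 2)
    = Hfun A / (2 * Real.pi * ρ ^ 2 * m ^ 2) by field_simp] at h
  refine h.congr' ?_
  filter_upwards [hn0] with i hi
  have hni : (n i : ℂ) ≠ 0 := by exact_mod_cast hi
  have hMi : ((M i + 1 : ℕ) : ℂ) ≠ 0 := Nat.cast_ne_zero.2 (Nat.succ_ne_zero (M i))
  have e : bker ρ (M i) (x i) (y i) = (∑ k ∈ Finset.range (M i + 1),
      ((k:ℂ) + 1) * (x i * conj (y i) / ρ ^ 2) ^ k) / (Real.pi * ρ ^ 2) := by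
    rw [bker, Finset.sum_div]
    refine Finset.sum_congr rfl fun k _ => ?_
    push_cast
    rw [div_pow, ← pow_mul]
    field_simp
    ring
  rw [e]
  field_simp


lemma quot_lim {ι : Type*} {l : Filter ι} {m : ℕ} (hm : 0 < m) {n M : ι → ℕ} (C : ℝ)
    (hn : Tendsto n l atTop) (hC : ∀ᶠ i in l, |(m * M i : ℝ) - n i| ≤ C) :
    Tendsto (fun i => (M i : ℂ) / n i) l (𝓝 (1 / m)) := by
  have hm0 : (0:ℝ) < m := by exact_mod_cast hm
  have hn0 : ∀ᶠ i in l, n i ≠ 0 := hn.eventually (eventually_ne_atTop 0)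
  have hnc : Tendsto (fun i => C / m * ((n i : ℝ))⁻¹) l (𝓝 0) := by
    have := ((tendsto_inv_atTop_nhds_zero_nat (𝕜 := ℝ)).comp hn).const_mul (C / m)
    simpa using this
  have h : Tendsto (fun i => (M i : ℝ) / n i) l (𝓝 (1 / m)) := by
    rw [tendsto_iff_norm_sub_tendsto_zero]
    refine squeeze_zero' (Eventually.of_forall fun _ => norm_nonneg _) ?_ hnc
    filter_upwards [hn0, hC] with i hi hCi
    have hi' : (0:ℝ) < n i := by exact_mod_cast Nat.pos_of_ne_zero hi
    have e : (M i : ℝ) / n i - 1 / m = ((m * M i : ℝ) - n i) / (m * n i) := by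
      field_simp
    rw [e, norm_div, Real.norm_eq_abs, Real.norm_of_nonneg (by positivity)]
    rw [div_le_iff₀ (by positivity)]
    refine hCi.trans (le_of_eq ?_)
    field_simp
  have := (Complex.continuous_ofReal.tendsto _).comp h
  push_cast at this
  refine this.congr fun i => ?_
  simp

section
variable {ι : Type*} {l : Filter ι} {m : ℕ} {n : ι → ℕ} {z a b : ι → ℂ} {z0 a0 b0 : ℂ}

lemma delta_lim (hn : Tendsto n l atTop) (hz : Tendsto z l (𝓝 z0)) (ha : Tendsto a l (𝓝 a0)) :
    Tendsto (fun i => (n i : ℂ) * ((z i + a i / n i) ^ m - z i ^ m)) l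
      (𝓝 (m * a0 * z0 ^ (m - 1))) := by
  have hn0 : ∀ᶠ i in l, n i ≠ 0 := hn.eventually (eventually_ne_atTop 0)
  have hnc : Tendsto (fun i => ((n i : ℂ))⁻¹) l (𝓝 0) :=
    (tendsto_inv_atTop_nhds_zero_nat (𝕜 := ℂ)).comp hn
  have hw : Tendsto (fun i => z i + a i / n i) l (𝓝 z0) := by
    have := hz.add (ha.mul hnc)
    simpa [div_eq_mul_inv] using this
  have h : Tendsto (fun i => a i * ∑ j ∈ Finset.range m, (z i + a i / n i) ^ j * z i ^ (m - 1 - j)) l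
      (𝓝 (a0 * ∑ j ∈ Finset.range m, z0 ^ j * z0 ^ (m - 1 - j))) :=
    ha.mul (tendsto_finsetSum _ fun j _ => (hw.pow j).mul (hz.pow _))
  have e : a0 * ∑ j ∈ Finset.range m, z0 ^ j * z0 ^ (m - 1 - j) = m * a0 * z0 ^ (m - 1) := by
    rw [Finset.sum_congr rfl (g := fun _ => z0 ^ (m - 1))]
    · simp; ring
    · intro j hj
      have := Finset.mem_range.1 hj
      rw [← pow_add]; congr 1; omega
  rw [e] at h
  refine h.congr' ?_
  filter_upwards [hn0] with i hi
  have hi' : (n i : ℂ) ≠ 0 := by exact_mod_cast hi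
  rw [← (Commute.all (z i + a i / n i) (z i)).geom_sum₂_mul m]
  rw [add_sub_cancel_left]
  field_simp

lemma q_lim {ρ : ℝ} (hρ : 0 < ρ) (hn : Tendsto n l atTop) (hz : Tendsto z l (𝓝 z0))
    (ha : Tendsto a l (𝓝 a0)) (hb : Tendsto b l (𝓝 b0)) (hzb : ∀ᶠ i in l, ‖z i ^ m - 1‖ = ρ) :
    Tendsto (fun i => (n i : ℂ) * (((z i + a i / n i) ^ m - 1) * conj ((z i + b i / n i) ^ m - 1)
      / (ρ:ℂ) ^ 2 - 1)) l
      (𝓝 (m * ((conj ((z0 ^ m - 1) / (ρ:ℂ)) * a0 * z0 ^ (m - 1)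
              + ((z0 ^ m - 1) / (ρ:ℂ)) * conj b0 * (conj z0) ^ (m - 1)) / (ρ:ℂ)))) := by
  have hρ0 : (ρ:ℂ) ≠ 0 := by exact_mod_cast hρ.ne'
  have hn0 : ∀ᶠ i in l, n i ≠ 0 := hn.eventually (eventually_ne_atTop 0)
  have hnc : Tendsto (fun i => ((n i : ℂ))⁻¹) l (𝓝 0) :=
    (tendsto_inv_atTop_nhds_zero_nat (𝕜 := ℂ)).comp hn
  have h1 := delta_lim (m := m) hn hz ha
  have h2 := delta_lim (m := m) hn hz hb
  have hv : Tendsto (fun i => z i ^ m - 1) l (𝓝 (z0 ^ m - 1)) := (hz.pow m).sub_const 1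
  have h2c := (Complex.continuous_conj.tendsto _).comp h2
  have hvc := (Complex.continuous_conj.tendsto _).comp hv
  have h := (((hvc.mul h1).add (hv.mul h2c)).add ((h1.mul h2c).mul hnc)).div_const ((ρ:ℂ) ^ 2)
  have e : ∀ x y : ℂ, x = y → Tendsto (fun i => (n i : ℂ) * (((z i + a i / n i) ^ m - 1) * conj ((z i + b i / n i) ^ m - 1)
      / (ρ:ℂ) ^ 2 - 1)) l (𝓝 x) → Tendsto (fun i => (n i : ℂ) * (((z i + a i / n i) ^ m - 1) * conj ((z i + b i / n i) ^ m - 1)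
      / (ρ:ℂ) ^ 2 - 1)) l (𝓝 y) := by rintro x y rfl h; exact h
  refine e _ _ ?_ (h.congr' ?_)
  · simp only [map_mul, map_div₀, Complex.conj_ofReal, map_pow, map_natCast]
    field_simp
    ring
  · filter_upwards [hn0, hzb] with i hi hzi
    have hi' : (n i : ℂ) ≠ 0 := by exact_mod_cast hi
    have hv2 : (z i ^ m - 1) * conj (z i ^ m - 1) = (ρ:ℂ) ^ 2 := by
      rw [Complex.mul_conj']; rw [hzi]
    simp only [Function.comp_apply, map_mul, map_natCast]
    have hne : (z i ^ m - 1) * conj (z i ^ m - 1) ≠ 0 := by rw [hv2]; exact pow_ne_zero _ hρ0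
    rw [← hv2]
    rw [div_sub_one hne, mul_div_assoc']
    congr 1
    simp only [map_sub, map_one, map_pow]
    field_simp
    ring

/-- the limiting kernel -/
noncomputable def Lk (m : ℕ) (ρ : ℝ) (z0 a b : ℂ) : ℂ :=
  Hfun ((conj ((z0 ^ m - 1) / (ρ:ℂ)) * a * z0 ^ (m - 1)
    + ((z0 ^ m - 1) / (ρ:ℂ)) * conj b * (conj z0) ^ (m - 1)) / (ρ:ℂ))
    * (z0 ^ (m - 1) * conj (z0 ^ (m - 1))) / (2 * Real.pi * ρ ^ 2)

lemma F_lim (hm : 0 < m) {ρ : ℝ} (hρ : 0 < ρ) (hn : Tendsto n l atTop) (hz : Tendsto z l (𝓝 z0))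
    (ha : Tendsto a l (𝓝 a0)) (hb : Tendsto b l (𝓝 b0)) (hzb : ∀ᶠ i in l, ‖z i ^ m - 1‖ = ρ)
    (Q : Polynomial ℂ) {M : ι → ℕ} (hM : Tendsto (fun i => (M i : ℂ) / n i) l (𝓝 (1 / m))) :
    Tendsto (fun i => (m ^ 2 * ((z i + a i / n i) ^ (m - 1) * Q.eval (z i + a i / n i)) *
        conj ((z i + b i / n i) ^ (m - 1) * Q.eval (z i + b i / n i)) *
        bker ρ (M i) ((z i + a i / n i) ^ m - 1) ((z i + b i / n i) ^ m - 1)) / (n i : ℂ) ^ 2) l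
      (𝓝 (((‖Q.eval z0‖ ^ 2 : ℝ) : ℂ) * Lk m ρ z0 a0 b0)) := by
  have hρ0 : (ρ:ℂ) ≠ 0 := by exact_mod_cast hρ.ne'
  have hm0 : (m:ℂ) ≠ 0 := by exact_mod_cast hm.ne'
  have hpi : (Real.pi:ℂ) ≠ 0 := by exact_mod_cast Real.pi_ne_zero
  have hnc : Tendsto (fun i => ((n i : ℂ))⁻¹) l (𝓝 0) :=
    (tendsto_inv_atTop_nhds_zero_nat (𝕜 := ℂ)).comp hn
  have hw : Tendsto (fun i => z i + a i / n i) l (𝓝 z0) := by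
    have := hz.add (ha.mul hnc)
    simpa [div_eq_mul_inv] using this
  have hw' : Tendsto (fun i => z i + b i / n i) l (𝓝 z0) := by
    have := hz.add (hb.mul hnc)
    simpa [div_eq_mul_inv] using this
  have hc : Continuous fun x : ℂ => x ^ (m - 1) * Q.eval x := by fun_prop
  have h1 := (hc.tendsto _).comp hw
  have h2 := ((Complex.continuous_conj.comp hc).tendsto _).comp hw'
  have h3 := bker_lim hρ hm hn hM (q_lim hρ hn hz ha hb hzb)
  have h := ((h1.const_mul ((m:ℂ) ^ 2)).mul h2).mul h3
  have e : ((‖Q.eval z0‖ ^ 2 : ℝ) : ℂ) = Q.eval z0 * conj (Q.eval z0) := by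
    rw [Complex.mul_conj']; push_cast; rfl
  have e2 : ((‖Q.eval z0‖ ^ 2 : ℝ) : ℂ) * Lk m ρ z0 a0 b0 = ((m:ℂ) ^ 2 * (z0 ^ (m - 1) * Q.eval z0)) *
      conj (z0 ^ (m - 1) * Q.eval z0) * (Hfun ((conj ((z0 ^ m - 1) / (ρ:ℂ)) * a0 * z0 ^ (m - 1)
    + ((z0 ^ m - 1) / (ρ:ℂ)) * conj b0 * (conj z0) ^ (m - 1)) / (ρ:ℂ)) / (2 * Real.pi * ρ ^ 2 * m ^ 2)) := by
    rw [e, Lk]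
    generalize Hfun _ = H
    rw [map_mul]
    field_simp
  rw [e2]
  refine h.congr fun i => ?_
  simp only [Function.comp_apply]
  ring

end


lemma re_help (m n : ℕ) (x : ℂ) (ρ : ℝ) (M : ℕ) (y : ℂ) :
    (((m:ℂ) ^ 2 * x * conj x * bker ρ M y y) / (n:ℂ) ^ 2).re
      = m ^ 2 * ‖x‖ ^ 2 * (bker ρ M y y).re / n ^ 2 := by
  rw [bker_diag_re, mul_assoc ((m:ℂ) ^ 2), Complex.mul_conj']
  have : ((m:ℂ) ^ 2 * (‖x‖:ℂ) ^ 2 * ((bker ρ M y y).re : ℂ)) / (n:ℂ) ^ 2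
      = ((m ^ 2 * ‖x‖ ^ 2 * (bker ρ M y y).re / n ^ 2 : ℝ) : ℂ) := by push_cast; rfl
  rw [this, Complex.ofReal_re, Complex.ofReal_re]

lemma diag_upper {ι : Type*} {l : Filter ι} {m : ℕ} {n : ι → ℕ} {z a : ι → ℂ}
    {z0 a0 : ℂ} (hm : 0 < m) {r : ℝ} (hρ : 0 < r ^ m) (hρ1 : r ^ m < 1)
    {φ : ℕ → Polynomial ℂ} {κ : ℕ → ℝ}
    (hON : IsOrthonormalPolys (volume.restrict (lemniscate r m)) φ κ)
    {c0 : ℂ} (hc0 : c0 ∈ rts m) {ε : ℝ} (hε : 0 < ε) (hε1 : (m + 2) * ε < 1) {Q : Polynomial ℂ}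
    (hQ : GoodQ m (r ^ m) c0 ε Q) (hz0 : ‖z0 ^ m - 1‖ = r ^ m)
    (hz0c : z0 = c0 * bet m (z0 ^ m - 1))
    (hn : Tendsto n l atTop) (hz : Tendsto z l (𝓝 z0))
    (ha : Tendsto a l (𝓝 a0)) (hzb : ∀ᶠ i in l, ‖z i ^ m - 1‖ = r ^ m) :
    ∃ u : ι → ℝ, Tendsto u l (𝓝 ((1 + (2 * m + 1) * ε) / (1 - (m + 2) * ε) ^ 2 *
        (Lk m (r ^ m) z0 a0 a0).re)) ∧
      ∀ᶠ i in l, (repKernel φ (n i) (z i + a i / n i) (z i + a i / n i)).re / (n i : ℝ) ^ 2 ≤ u i := by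
  have hmr : (0:ℝ) < m := by exact_mod_cast hm
  have hε1' : ε ≤ 1 := by nlinarith
  have hn0 : ∀ᶠ i in l, n i ≠ 0 := hn.eventually (eventually_ne_atTop 0)
  have hnc : Tendsto (fun i => ((n i : ℂ))⁻¹) l (𝓝 0) :=
    (tendsto_inv_atTop_nhds_zero_nat (𝕜 := ℂ)).comp hn
  have hw : Tendsto (fun i => z i + a i / n i) l (𝓝 z0) := by
    have := hz.add (ha.mul hnc)
    simpa [div_eq_mul_inv] using this
  have hM : Tendsto (fun i => (((n i + Q.natDegree) / m : ℕ) : ℂ) / n i) l (𝓝 (1 / m)) := by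
    refine quot_lim hm (Q.natDegree + m) hn (Eventually.of_forall fun i => ?_)
    have h1 := Nat.div_add_mod (n i + Q.natDegree) m
    have h2 := Nat.mod_lt (n i + Q.natDegree) hm
    set t := (n i + Q.natDegree) / m
    have h3 : (m * t : ℝ) + ((n i + Q.natDegree) % m : ℕ) = n i + Q.natDegree := by exact_mod_cast h1
    have h4 : (((n i + Q.natDegree) % m : ℕ) : ℝ) ≤ m := by exact_mod_cast h2.le
    have h5 : (0:ℝ) ≤ ((n i + Q.natDegree) % m : ℕ) := by positivity
    have h6 : (0:ℝ) ≤ Q.natDegree := by positivity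
    rw [abs_le]
    constructor <;> linarith
  have hF := F_lim hm hρ hn hz ha ha hzb 1 hM
  simp only [Polynomial.eval_one, norm_one, one_pow, Complex.ofReal_one, one_mul, mul_one] at hF
  have hFr := ((Complex.continuous_re.tendsto _).comp hF).const_mul
    ((1 + (2 * m + 1) * ε) / (1 - (m + 2) * ε) ^ 2)
  refine ⟨_, hFr, ?_⟩
  have hτ : Tendsto (fun i => ‖Q.eval (z i + a i / n i)‖ -
      ∑ c ∈ (rts m).erase 1, ‖Q.eval (c * (z i + a i / n i))‖) l
      (𝓝 (‖Q.eval z0‖ - ∑ c ∈ (rts m).erase 1, ‖Q.eval (c * z0)‖)) := by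
    have hc : Continuous fun x : ℂ => ‖Q.eval x‖ - ∑ c ∈ (rts m).erase 1, ‖Q.eval (c * x)‖ := by
      fun_prop
    exact (hc.tendsto _).comp hw
  have hc00 : c0 ≠ 0 := by
    rintro rfl
    have := (mem_rts hm).1 hc0
    rw [zero_pow hm.ne'] at this
    exact zero_ne_one this
  have hτ0 : 1 - (m + 2) * ε < ‖Q.eval z0‖ - ∑ c ∈ (rts m).erase 1, ‖Q.eval (c * z0)‖ := by
    have h1 : 1 - ε ≤ ‖Q.eval z0‖ := by
      have h := hQ c0 hc0 (z0 ^ m - 1) hz0.le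
      rw [← hz0c, if_pos rfl] at h
      have h2 := norm_sub_norm_le (1:ℂ) (Q.eval z0)
      rw [norm_one, norm_sub_rev] at h2
      linarith
    have h2 : ∑ c ∈ (rts m).erase 1, ‖Q.eval (c * z0)‖ ≤ ∑ c ∈ (rts m).erase 1, ε := by
      refine Finset.sum_le_sum fun c hc => ?_
      rw [Finset.mem_erase] at hc
      have hcc : c * c0 ∈ rts m := by
        rw [mem_rts hm, mul_pow, (mem_rts hm).1 hc.2, (mem_rts hm).1 hc0, one_mul]
      have h := hQ (c * c0) hcc (z0 ^ m - 1) hz0.le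
      rw [mul_assoc, ← hz0c, if_neg (fun h => hc.1 (mul_right_cancel₀ hc00 (h.trans (one_mul _).symm))),
        sub_zero] at h
      exact h
    rw [Finset.sum_const, nsmul_eq_mul] at h2
    have h3 : (((rts m).erase 1).card : ℝ) ≤ m := by
      have := Finset.card_erase_le (s := rts m) (a := 1)
      rw [rts_card hm] at this
      exact_mod_cast this
    nlinarith
  filter_upwards [hτ.eventually (lt_mem_nhds hτ0), hn0] with i hi hni
  have hni' : (0:ℝ) < n i := by exact_mod_cast Nat.pos_of_ne_zero hni
  have hub := upper_bound hm hρ hρ1 hON hc0 hε hε1' hQ (n i) (z i + a i / n i) (by linarith)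
  simp only [Function.comp_apply]
  rw [re_help, norm_pow]
  set w := z i + a i / n i
  set τ := ‖Q.eval w‖ - ∑ c ∈ (rts m).erase 1, ‖Q.eval (c * w)‖
  set t := 1 - (m + 2) * ε
  have ht : 0 < t := by simp only [t]; linarith
  have hK := rker_nonneg φ (n i) w
  have h1 : (repKernel φ (n i) w w).re * t ^ 2 ≤ (repKernel φ (n i) w w).re * τ ^ 2 := by gcongr
  have h2 := h1.trans hub
  rw [← le_div_iff₀ (by positivity)] at h2
  calc _ ≤ (1 + (2 * m + 1) * ε) * (m * ‖w‖ ^ (m - 1)) ^ 2 *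
        (bker (r ^ m) ((n i + Q.natDegree) / m) (w ^ m - 1) (w ^ m - 1)).re / t ^ 2 / (n i : ℝ) ^ 2 := by
        gcongr
    _ = _ := by field_simp

lemma eps_lim {ι : Type*} {l : Filter ι} {m : ℕ} {n : ι → ℕ} {z a b : ι → ℂ}
    {z0 a0 b0 : ℂ} (hm : 0 < m) {r : ℝ} (hρ : 0 < r ^ m) (hρ1 : r ^ m < 1)
    {φ : ℕ → Polynomial ℂ} {κ : ℕ → ℝ}
    (hON : IsOrthonormalPolys (volume.restrict (lemniscate r m)) φ κ)
    (hz0 : ‖z0 ^ m - 1‖ = r ^ m)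
    (hn : Tendsto n l atTop) (hz : Tendsto z l (𝓝 z0))
    (ha : Tendsto a l (𝓝 a0)) (hb : Tendsto b l (𝓝 b0))
    (hzb : ∀ᶠ i in l, ‖z i ^ m - 1‖ = r ^ m)
    (ε : ℝ) (hε : 0 < ε) (hε1 : (m + 2) * ε < 1) :
    ∃ θ : ℝ, |θ - 1| ≤ 3 * ε ∧ ∃ E : ι → ℝ,
      Tendsto E l (𝓝 (‖(θ:ℂ) * Lk m (r ^ m) z0 a0 b0 - Lk m (r ^ m) z0 a0 b0‖ +
        √((1 + (2 * m + 1) * ε) / (1 - (m + 2) * ε) ^ 2 * (Lk m (r ^ m) z0 a0 a0).re *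
          |(1 + (2 * m + 1) * ε) / (1 - (m + 2) * ε) ^ 2 * (Lk m (r ^ m) z0 b0 b0).re -
            (1 - (m + 2) * ε) * (θ * (Lk m (r ^ m) z0 b0 b0).re)|))) ∧
      ∀ᶠ i in l, ‖repKernel φ (n i) (z i + a i / n i) (z i + b i / n i) / (n i : ℂ) ^ 2
        - Lk m (r ^ m) z0 a0 b0‖ ≤ E i := by
  have hmr : (0:ℝ) < m := by exact_mod_cast hm
  have hε1' : ε ≤ 1 := by nlinarith
  have hbne : bet m (z0 ^ m - 1) ≠ 0 := bet_ne hm (hz0.trans_lt hρ1)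
  set c0 := z0 / bet m (z0 ^ m - 1) with hc0d
  have hz0c : z0 = c0 * bet m (z0 ^ m - 1) := by rw [hc0d]; field_simp
  have hc0 : c0 ∈ rts m := by
    have hp := bet_pow hm (z0 ^ m - 1)
    rw [mem_rts hm, hc0d, div_pow, hp, div_eq_one_iff_eq]
    · ring
    · rw [← hp]; exact pow_ne_zero _ hbne
  obtain ⟨Q, hQ⟩ := exists_Q hm hρ hρ1 hc0 ε hε
  have hQ : GoodQ m (r ^ m) c0 ε Q := hQ
  obtain ⟨u, hu, huK⟩ := diag_upper hm hρ hρ1 hON hc0 hε hε1 hQ hz0 hz0c hn hz ha hzb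
  obtain ⟨u', hu', huK'⟩ := diag_upper hm hρ hρ1 hON hc0 hε hε1 hQ hz0 hz0c hn hz hb hzb
  have hnlarge : ∀ᶠ i in l, (m - 1) + Q.natDegree + 1 ≤ n i := hn.eventually (eventually_ge_atTop _)
  set N : ι → ℕ := fun i => (n i - ((m - 1) + Q.natDegree)) / m with hNd
  have hN : ∀ᶠ i in l, (m - 1) + Q.natDegree + m * N i ≤ n i := by
    filter_upwards [hnlarge] with i hi
    have := Nat.mul_div_le (n i - ((m - 1) + Q.natDegree)) m
    simp only [hNd]
    omega
  have hM : Tendsto (fun i => (N i : ℂ) / n i) l (𝓝 (1 / m)) := by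
    refine quot_lim hm (Q.natDegree + 2 * m) hn ?_
    filter_upwards [hnlarge, hN] with i hi hNi
    have h1 := Nat.div_add_mod (n i - ((m - 1) + Q.natDegree)) m
    have h2 := Nat.mod_lt (n i - ((m - 1) + Q.natDegree)) hm
    have h3 : m * N i ≤ n i := by omega
    have h4 : n i ≤ m * N i + Q.natDegree + 2 * m := by simp only [hNd]; omega
    have h3' : (m * N i : ℝ) ≤ n i := by exact_mod_cast h3
    have h4' : (n i : ℝ) ≤ m * N i + Q.natDegree + 2 * m := by exact_mod_cast h4
    rw [abs_le]
    constructor <;> linarith [(Nat.cast_nonneg Q.natDegree : (0:ℝ) ≤ _)]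
  have hF := F_lim hm hρ hn hz ha hb hzb Q hM
  have hD := (Complex.continuous_re.tendsto _).comp (F_lim hm hρ hn hz hb hb hzb Q hM)
  rw [Complex.re_ofReal_mul] at hD
  refine ⟨‖Q.eval z0‖ ^ 2, ?_, _, ((hF.sub_const (Lk m (r ^ m) z0 a0 b0)).norm).add
    ((Real.continuous_sqrt.tendsto _).comp (hu.mul (hu'.sub (hD.const_mul (1 - (m + 2) * ε))).abs)), ?_⟩
  · have h := hQ c0 hc0 (z0 ^ m - 1) hz0.le
    rw [← hz0c, if_pos rfl] at h
    have h1 := abs_norm_sub_norm_le (Q.eval z0) 1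
    rw [norm_one] at h1
    have h2 := abs_le.1 (h1.trans h)
    have h3 := norm_nonneg (Q.eval z0)
    rw [abs_le]
    constructor <;> nlinarith
  · filter_upwards [huK, huK', hN, hnlarge] with i h1 h2 h3 h4
    have hni : (0:ℝ) < n i := by exact_mod_cast (by omega : 0 < n i)
    have hnc : (n i : ℂ) ≠ 0 := by exact_mod_cast (by omega : n i ≠ 0)
    have hcb := comb hm hρ hρ1 hON hc0 hε hε1' hQ (n i) (N i) h3 (z i + a i / n i) (z i + b i / n i)
    simp only [Function.comp_apply]
    rw [re_help]
    set w := z i + a i / n i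
    set w' := z i + b i / n i
    set F := (m:ℂ) ^ 2 * (w ^ (m - 1) * Q.eval w) * conj (w' ^ (m - 1) * Q.eval w') *
        bker (r ^ m) (N i) (w ^ m - 1) (w' ^ m - 1)
    set D := (m:ℝ) ^ 2 * ‖w' ^ (m - 1) * Q.eval w'‖ ^ 2 *
          (bker (r ^ m) (N i) (w' ^ m - 1) (w' ^ m - 1)).re
    set k := (repKernel φ (n i) w w).re
    set k' := (repKernel φ (n i) w' w').re
    set c := 1 - (m + 2) * ε
    have hk : 0 ≤ k := rker_nonneg _ _ _
    have key : ‖F / (n i : ℂ) ^ 2 - repKernel φ (n i) w w' / (n i : ℂ) ^ 2‖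
        ≤ √(u i * |u' i - c * (D / (n i : ℝ) ^ 2)|) := by
      refine Real.le_sqrt_of_sq_le ?_
      rw [← sub_div, norm_div, norm_pow, Complex.norm_natCast, div_pow]
      calc _ ≤ k * (k' - c * D) / ((n i : ℝ) ^ 2) ^ 2 := by gcongr
        _ = (k / (n i : ℝ) ^ 2) * (k' / (n i : ℝ) ^ 2 - c * (D / (n i : ℝ) ^ 2)) := by
          field_simp
        _ ≤ (k / (n i : ℝ) ^ 2) * |u' i - c * (D / (n i : ℝ) ^ 2)| := by
          gcongr
          exact le_trans (by linarith) (le_abs_self _)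
        _ ≤ _ := by gcongr
    have e : repKernel φ (n i) w w' / (n i : ℂ) ^ 2 - Lk m (r ^ m) z0 a0 b0
      = (F / (n i : ℂ) ^ 2 - Lk m (r ^ m) z0 a0 b0) -
        (F / (n i : ℂ) ^ 2 - repKernel φ (n i) w w' / (n i : ℂ) ^ 2) := by ring
    rw [e]
    exact (norm_sub_le _ _).trans (by gcongr)

lemma main_lim {ι : Type*} {l : Filter ι} {m : ℕ} {n : ι → ℕ} {z a b : ι → ℂ}
    {z0 a0 b0 : ℂ} (hm : 0 < m) {r : ℝ} (hρ : 0 < r ^ m) (hρ1 : r ^ m < 1)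
    {φ : ℕ → Polynomial ℂ} {κ : ℕ → ℝ}
    (hON : IsOrthonormalPolys (volume.restrict (lemniscate r m)) φ κ)
    (hz0 : ‖z0 ^ m - 1‖ = r ^ m)
    (hn : Tendsto n l atTop) (hz : Tendsto z l (𝓝 z0))
    (ha : Tendsto a l (𝓝 a0)) (hb : Tendsto b l (𝓝 b0))
    (hzb : ∀ᶠ i in l, ‖z i ^ m - 1‖ = r ^ m) :
    Tendsto (fun i => repKernel φ (n i) (z i + a i / n i) (z i + b i / n i) / (n i : ℂ) ^ 2) l
      (𝓝 (Lk m (r ^ m) z0 a0 b0)) := by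
  have hmr : (0:ℝ) < m := by exact_mod_cast hm
  have H := eps_lim hm hρ hρ1 hON hz0 hn hz ha hb hzb
  set La := (Lk m (r ^ m) z0 a0 a0).re
  set Lb := (Lk m (r ^ m) z0 b0 b0).re
  set L := Lk m (r ^ m) z0 a0 b0
  choose! θ hθ E hE hKE using H
  have hsmall : ∀ᶠ ε : ℝ in 𝓝[>] 0, 0 < ε ∧ (m + 2) * ε < 1 := by
    have h1 : ∀ᶠ ε : ℝ in 𝓝[>] 0, 0 < ε := eventually_mem_nhdsWithin
    have h2 : ∀ᶠ ε : ℝ in 𝓝[>] 0, (m + 2) * ε < 1 := by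
      have : Continuous fun ε : ℝ => (m + 2) * ε := by fun_prop
      exact (this.tendsto' 0 0 (by simp)).mono_left nhdsWithin_le_nhds |>.eventually (gt_mem_nhds one_pos)
    exact h1.and h2
  have hid : Tendsto (fun ε : ℝ => ε) (𝓝[>] 0) (𝓝 0) := nhdsWithin_le_nhds
  have hθ1 : Tendsto θ (𝓝[>] 0) (𝓝 1) := by
    rw [tendsto_iff_norm_sub_tendsto_zero]
    refine squeeze_zero' (g := fun ε => 3 * ε) (Eventually.of_forall fun _ => norm_nonneg _) ?_ ?_
    · filter_upwards [hsmall] with ε hε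
      exact hθ ε hε.1 hε.2
    · simpa using hid.const_mul 3
  have hg : Tendsto (fun ε : ℝ => ‖(θ ε:ℂ) * L - L‖ +
        √((1 + (2 * m + 1) * ε) / (1 - (m + 2) * ε) ^ 2 * La *
          |(1 + (2 * m + 1) * ε) / (1 - (m + 2) * ε) ^ 2 * Lb -
            (1 - (m + 2) * ε) * (θ ε * Lb)|)) (𝓝[>] 0) (𝓝 0) := by
    have h1 : Tendsto (fun ε : ℝ => (1 + (2 * m + 1) * ε)) (𝓝[>] 0) (𝓝 1) := by
      simpa using (hid.const_mul ((2 * m + 1 : ℝ))).const_add 1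
    have h2 : Tendsto (fun ε : ℝ => (1 - (m + 2) * ε)) (𝓝[>] 0) (𝓝 1) := by
      simpa using (hid.const_mul ((m + 2 : ℝ))).const_sub 1
    have h3 : Tendsto (fun ε : ℝ => (1 + (2 * m + 1) * ε) / (1 - (m + 2) * ε) ^ 2) (𝓝[>] 0) (𝓝 1) := by
      have := h1.div (h2.pow 2) (by norm_num)
      rw [one_pow, div_one] at this
      exact this
    have h4 := ((((Complex.continuous_ofReal.tendsto _).comp hθ1).mul_const L).sub_const L).norm
    have h5 := (h3.mul_const La).mul ((h3.mul_const Lb).sub (h2.mul (hθ1.mul_const Lb))).abs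
    have h6 := h4.add ((Real.continuous_sqrt.tendsto _).comp h5)
    simpa using h6
  rw [Metric.tendsto_nhds]
  intro η hη
  obtain ⟨ε, hε, hεg⟩ := (hsmall.and (hg.eventually (gt_mem_nhds hη))).exists
  filter_upwards [hKE ε hε.1 hε.2, (hE ε hε.1 hε.2).eventually (gt_mem_nhds hεg)] with i h1 h2
  rw [dist_eq_norm]
  exact h1.trans_lt h2

/-- **Theorem 3.7.** Off-diagonal kernel asymptotics for area measure on the lemniscate
`G_{r,m}`, uniformly for `z₀` in a compact subset of the boundary and `a, b` in compact
subsets of `ℂ`. -/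
theorem statement_17
    (r : ℝ) (hr0 : 0 < r) (hr1 : r < 1) (m : ℕ) (hm : 2 ≤ m)
    (φ : ℕ → Polynomial ℂ) (κ : ℕ → ℝ)
    (hON : IsOrthonormalPolys (volume.restrict (lemniscate r m)) φ κ)
    (J : Set ℂ) (hJc : IsCompact J) (hJ : J ⊆ frontier (lemniscate r m)) :
    ∀ K : Set ℂ, IsCompact K →
      TendstoUniformlyOn
        (fun (n : ℕ) (p : ℂ × ℂ × ℂ) =>
          repKernel φ n (p.1 + p.2.1 / (n:ℂ)) (p.1 + p.2.2 / (n:ℂ)) / (n:ℂ) ^ 2)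
        (fun p =>
          Hfun ((conj ((p.1 ^ m - 1) / (r:ℂ) ^ m) * p.2.1 * p.1 ^ (m - 1)
              + ((p.1 ^ m - 1) / (r:ℂ) ^ m) * conj p.2.2 * (conj p.1) ^ (m - 1))
            / (r:ℂ) ^ m)
          * ((‖p.1‖ ^ (2 * m - 2) : ℝ) : ℂ)
          / (((2 * Real.pi * r ^ (2 * m) : ℝ)) : ℂ))
        atTop (J ×ˢ K ×ˢ K) := by
  intro K hK
  have hm0 : 0 < m := by omega
  have hρ : 0 < r ^ m := by positivity
  have hρ1 : r ^ m < 1 := pow_lt_one₀ hr0.le hr1 hm0.ne'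
  have hrm : ((r:ℂ) ^ m) ≠ 0 := pow_ne_zero _ (by exact_mod_cast hr0.ne')
  have hlim : (fun p : ℂ × ℂ × ℂ =>
          Hfun ((conj ((p.1 ^ m - 1) / (r:ℂ) ^ m) * p.2.1 * p.1 ^ (m - 1)
              + ((p.1 ^ m - 1) / (r:ℂ) ^ m) * conj p.2.2 * (conj p.1) ^ (m - 1))
            / (r:ℂ) ^ m)
          * ((‖p.1‖ ^ (2 * m - 2) : ℝ) : ℂ)
          / (((2 * Real.pi * r ^ (2 * m) : ℝ)) : ℂ)) = fun p => Lk m (r ^ m) p.1 p.2.1 p.2.2 := by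
    funext p
    rw [Lk, Complex.mul_conj', norm_pow]
    push_cast
    congr 2
    · rw [← pow_mul]; congr 2; omega
    · rw [← pow_mul, mul_comm 2 m]
  rw [hlim]
  have hcont : Continuous fun p : ℂ × ℂ × ℂ => Lk m (r ^ m) p.1 p.2.1 p.2.2 := by
    unfold Lk
    have := Hfun_continuous
    have hc := Complex.continuous_conj
    fun_prop
  have hbd : ∀ z ∈ J, ‖z ^ m - 1‖ = r ^ m := fun z hz =>
    frontier_lt_subset_eq (f := fun z : ℂ => ‖z ^ m - 1‖) (by fun_prop) continuous_const (hJ hz)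
  have hS : IsCompact (J ×ˢ K ×ˢ K) := hJc.prod (hK.prod hK)
  rw [← tendstoLocallyUniformlyOn_iff_tendstoUniformlyOn_of_compact hS,
    tendstoLocallyUniformlyOn_iff_forall_tendsto]
  rintro ⟨z0, a0, b0⟩ hp
  have hsnd : Tendsto (fun y : ℕ × (ℂ × ℂ × ℂ) => y.2) (atTop ×ˢ 𝓝[J ×ˢ K ×ˢ K] (z0, a0, b0))
      (𝓝 (z0, a0, b0)) := tendsto_snd.mono_right nhdsWithin_le_nhds
  have hmain := main_lim (l := atTop ×ˢ 𝓝[J ×ˢ K ×ˢ K] (z0, a0, b0))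
    (n := fun y : ℕ × (ℂ × ℂ × ℂ) => y.1) (z := fun y => y.2.1) (a := fun y => y.2.2.1)
    (b := fun y => y.2.2.2) (z0 := z0) (a0 := a0) (b0 := b0) hm0 hρ hρ1 hON
    (hbd _ hp.1) tendsto_fst
    ((continuous_fst.tendsto _).comp hsnd)
    (((continuous_fst.comp continuous_snd).tendsto _).comp hsnd)
    (((continuous_snd.comp continuous_snd).tendsto _).comp hsnd)
    (by
      have : ∀ᶠ y : ℕ × (ℂ × ℂ × ℂ) in atTop ×ˢ 𝓝[J ×ˢ K ×ˢ K] (z0, a0, b0), y.2 ∈ J ×ˢ K ×ˢ K :=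
        tendsto_snd.eventually eventually_mem_nhdsWithin
      filter_upwards [this] with y hy
      exact hbd _ hy.1)
  have h2 := (hcont.tendsto _).comp hsnd
  rw [Metric.uniformity_eq_comap_nhds_zero, tendsto_comap_iff]
  have h3 := h2.dist hmain
  rw [dist_self] at h3
  exact h3
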